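/- arXiv:1304.3871 — 7 statements merged into one kernel-verified Lean document; each statement's English description precedes it below -/
import Mathlib

section
/- Let (X,d,μ) be an Ahlfors Q-regular metric measure space with Q ∈ (0,∞), let 1 < p ≤ q < ∞ and α > 0 with q < Q/α. Then there is a constant C > 0 such that for every nonnegative f ∈ M_p^q(X), every δ > 0 and every x ∈ X: ∫_{X ∖ B(x,δ)} f(y) / d(x,y)^{Q−α} dμ(y) ≤ C δ^{α − Q/q} ‖f‖_{M_p^q(X)}. -/
open MeasureTheory Metric ENNReal Filter

/-- The Morrey norm for real-valued functions. -/
noncomputable def morreyNorm {X : Type*} [MetricSpace X] [MeasurableSpace X]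
    (μ : Measure X) (p q : ℝ) (f : X → ℝ) : ℝ≥0∞ :=
  ⨆ (x : X) (r : ℝ) (_ : 0 < r),
    μ (ball x r) ^ (1 / q - 1 / p) *
      (∫⁻ y in ball x r, (‖f y‖₊ : ℝ≥0∞) ^ p ∂μ) ^ (1 / p)

/-- Hölder's inequality on a ball, in terms of the Morrey norm. -/
theorem setLIntegral_ball_le_morreyNorm {X : Type*} [MetricSpace X] [MeasurableSpace X]
    (μ : Measure X) {p q : ℝ} (hp : 1 < p) {f : X → ℝ} (hf : Measurable f)
    {x : X} {r : ℝ} (hr : 0 < r) (h0 : μ (ball x r) ≠ 0) (htop : μ (ball x r) ≠ ⊤) :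
    ∫⁻ y in ball x r, (‖f y‖₊ : ℝ≥0∞) ∂μ ≤
      μ (ball x r) ^ (1 - 1 / q) * morreyNorm μ p q f := by
  have hpq := Real.HolderConjugate.conjExponent hp
  have hconj : 1 / p.conjExponent = 1 - 1 / p := by
    have := hpq.inv_add_inv_eq_one
    rw [one_div, one_div]
    linarith
  have holder : ∫⁻ y in ball x r, (‖f y‖₊ : ℝ≥0∞) ∂μ ≤
      (∫⁻ y in ball x r, (‖f y‖₊ : ℝ≥0∞) ^ p ∂μ) ^ (1 / p) * μ (ball x r) ^ (1 - 1 / p) := by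
    have h := ENNReal.lintegral_mul_le_Lp_mul_Lq (μ.restrict (ball x r)) hpq
      (f := fun y => (‖f y‖₊ : ℝ≥0∞)) (g := fun _ => 1)
      hf.nnnorm.coe_nnreal_ennreal.aemeasurable aemeasurable_const
    simpa [hconj] using h
  have hM : μ (ball x r) ^ (1 / q - 1 / p) *
      (∫⁻ y in ball x r, (‖f y‖₊ : ℝ≥0∞) ^ p ∂μ) ^ (1 / p) ≤ morreyNorm μ p q f := by
    unfold morreyNorm
    exact le_iSup_of_le x (le_iSup_of_le r (le_iSup_of_le hr le_rfl))
  calc _ ≤ _ := holder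
    _ = μ (ball x r) ^ (1 - 1 / q) * (μ (ball x r) ^ (1 / q - 1 / p) *
      (∫⁻ y in ball x r, (‖f y‖₊ : ℝ≥0∞) ^ p ∂μ) ^ (1 / p)) := by
        rw [← mul_assoc, ← ENNReal.rpow_add _ _ h0 htop, mul_comm]
        congr 2
        ring
    _ ≤ _ := by gcongr

/-- The part of the Riesz potential coming from the annulus `ball x (a * r) \ ball x r`. -/
theorem setLIntegral_annulus_le_morreyNorm {X : Type*} [MetricSpace X] [MeasurableSpace X]
    [BorelSpace X] (μ : Measure X) {Q : ℝ} {A : ℝ} (hA : 0 ≤ A) {p q α : ℝ} (hp : 1 < p)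
    (hq : 1 ≤ q) (hαQ : α ≤ Q) {f : X → ℝ} (hf : Measurable f) {x : X} {a r : ℝ} (ha : 0 < a)
    (hr : 0 < r) (h0 : μ (ball x (a * r)) ≠ 0)
    (hup : μ (ball x (a * r)) ≤ ENNReal.ofReal (A * (a * r) ^ Q)) :
    ∫⁻ y in ball x (a * r) \ ball x r, (‖f y‖₊ : ℝ≥0∞) / edist x y ^ (Q - α) ∂μ ≤
      ENNReal.ofReal (A ^ (1 - 1 / q) * a ^ (Q - Q / q) * r ^ (α - Q / q)) *
        morreyNorm μ p q f := by
  have har : 0 < a * r := mul_pos ha hr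
  have hq1 : 0 ≤ 1 - 1 / q := by
    rw [sub_nonneg, div_le_one (by linarith)]
    exact hq
  calc _ ≤ ∫⁻ y in ball x (a * r) \ ball x r,
        ENNReal.ofReal (r ^ (α - Q)) * (‖f y‖₊ : ℝ≥0∞) ∂μ := by
        refine setLIntegral_mono' (measurableSet_ball.diff measurableSet_ball) fun y hy => ?_
        have hy' : ENNReal.ofReal r ≤ edist x y := by
          rw [edist_dist]
          refine ENNReal.ofReal_le_ofReal ?_
          simpa [dist_comm] using hy.2
        have hrw : ENNReal.ofReal (r ^ (α - Q)) = (ENNReal.ofReal r ^ (Q - α))⁻¹ := by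
          rw [← ENNReal.rpow_neg, neg_sub, ENNReal.ofReal_rpow_of_pos hr]
        rw [hrw, div_eq_mul_inv, mul_comm]
        gcongr
    _ ≤ ENNReal.ofReal (r ^ (α - Q)) * ∫⁻ y in ball x (a * r), (‖f y‖₊ : ℝ≥0∞) ∂μ := by
        rw [lintegral_const_mul _ hf.nnnorm.coe_nnreal_ennreal]
        gcongr
        exact Set.sdiff_subset
    _ ≤ ENNReal.ofReal (r ^ (α - Q)) *
        (ENNReal.ofReal (A * (a * r) ^ Q) ^ (1 - 1 / q) * morreyNorm μ p q f) := by
        gcongr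
        refine (setLIntegral_ball_le_morreyNorm μ hp hf har h0
          (ne_top_of_le_ne_top ENNReal.ofReal_ne_top hup) (q := q)).trans ?_
        gcongr
    _ = _ := by
        rw [ENNReal.ofReal_rpow_of_nonneg (by positivity) hq1, ← mul_assoc,
          ← ENNReal.ofReal_mul (by positivity)]
        congr 2
        rw [Real.mul_rpow hA (by positivity), ← Real.rpow_mul har.le,
          Real.mul_rpow ha.le hr.le, show Q * (1 - 1 / q) = Q - Q / q by ring,
          show α - Q / q = (α - Q) + (Q - Q / q) by ring, Real.rpow_add hr]
        ring

/-- The complement of a ball is covered by geometrically growing annuli. -/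
theorem compl_ball_subset_iUnion_annuli {X : Type*} [MetricSpace X] (x : X) {a δ : ℝ}
    (ha : 1 < a) (hδ : 0 < δ) :
    (ball x δ)ᶜ ⊆ ⋃ k : ℕ, ball x (a * (a ^ k * δ)) \ ball x (a ^ k * δ) := by
  intro y hy
  have hy' : δ ≤ dist y x := by simpa using hy
  obtain ⟨k, hk1, hk2⟩ := exists_nat_pow_near ((one_le_div hδ).2 hy') ha
  rw [le_div_iff₀ hδ] at hk1
  rw [div_lt_iff₀ hδ, pow_succ'] at hk2
  refine Set.mem_iUnion.2 ⟨k, ?_, ?_⟩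
  · simpa [mul_assoc] using hk2
  · simpa using hk1

theorem stmt4 {X : Type*} [MetricSpace X] [MeasurableSpace X] [BorelSpace X]
    (μ : Measure X) (Q : ℝ) (hQ : 0 < Q)
    (C_A : ℝ≥0∞) (hCA : 1 ≤ C_A) (hCA' : C_A < ⊤)
    (hreg : ∀ (x : X) (s : ℝ), 0 < s →
      ENNReal.ofReal s < 2 * EMetric.diam (Set.univ : Set X) →
      ENNReal.ofReal (s ^ Q) ≤ C_A * μ (ball x s) ∧
        μ (ball x s) ≤ C_A * ENNReal.ofReal (s ^ Q))
    (p q α : ℝ) (hp : 1 < p) (hpq : p ≤ q) (hα : 0 < α) (hq : q < Q / α) :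
    ∃ C : ℝ, 0 < C ∧
      ∀ f : X → ℝ, Measurable f → (∀ x, 0 ≤ f x) → morreyNorm μ p q f < ⊤ →
        ∀ (δ : ℝ), 0 < δ → ∀ x : X,
          (∫⁻ y in (ball x δ)ᶜ, (‖f y‖₊ : ℝ≥0∞) / edist x y ^ (Q - α) ∂μ) ≤
            ENNReal.ofReal (C * δ ^ (α - Q / q)) * morreyNorm μ p q f := by
  have hq1 : 1 < q := hp.trans_le hpq
  have hq0 : 0 < q := by linarith
  have hqα : q * α < Q := (lt_div_iff₀ hα).1 hq
  have hαQ : α ≤ Q := by nlinarith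
  have hβ : α - Q / q < 0 := by
    rw [sub_neg, lt_div_iff₀ hq0]
    linarith
  set β := α - Q / q with hβdef
  have hA : 0 < C_A.toReal := ENNReal.toReal_pos (by positivity) hCA'.ne
  set A := C_A.toReal
  have hCA_eq : C_A = ENNReal.ofReal A := (ENNReal.ofReal_toReal hCA'.ne).symm
  obtain ⟨a, ha1, ha2⟩ : ∃ a : ℝ, 1 < a ∧ a < 2 := ⟨3 / 2, by norm_num, by norm_num⟩
  have ha0 : 0 < a := by linarith
  have hρ : a ^ β < 1 := Real.rpow_lt_one_of_one_lt_of_neg ha1 hβ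
  have hρ0 : 0 < a ^ β := by positivity
  set K := A ^ (1 - 1 / q) * a ^ (Q - Q / q) with hK
  have hK0 : 0 < K := by positivity
  refine ⟨K * (1 - a ^ β)⁻¹, mul_pos hK0 (inv_pos.2 (by linarith)), ?_⟩
  intro f hf _ _ δ hδ x
  have hannulus : ∀ k : ℕ,
      ∫⁻ y in ball x (a * (a ^ k * δ)) \ ball x (a ^ k * δ),
        (‖f y‖₊ : ℝ≥0∞) / edist x y ^ (Q - α) ∂μ ≤
      ENNReal.ofReal (K * δ ^ β * (a ^ β) ^ k) * morreyNorm μ p q f := by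
    intro k
    have hr : 0 < a ^ k * δ := by positivity
    have hpow : K * δ ^ β * (a ^ β) ^ k = K * (a ^ k * δ) ^ β := by
      rw [Real.mul_rpow (by positivity) hδ.le, Real.rpow_pow_comm ha0.le]
      ring
    rw [hpow]
    generalize a ^ k * δ = r at hr ⊢
    rcases (ball x (a * r) \ ball x r).eq_empty_or_nonempty with he | ⟨y, -, hy⟩
    · simp [he]
    have hdiam : ENNReal.ofReal r ≤ Metric.ediam (Set.univ : Set X) := by
      refine le_trans ?_ (Metric.edist_le_ediam_of_mem (Set.mem_univ y) (Set.mem_univ x))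
      rw [edist_dist]
      exact ENNReal.ofReal_le_ofReal (by simpa using hy)
    have hs : ENNReal.ofReal (a * r) < 2 * Metric.ediam (Set.univ : Set X) := by
      refine lt_of_lt_of_le ?_ (mul_le_mul_right hdiam 2)
      rw [← ENNReal.ofReal_ofNat 2, ← ENNReal.ofReal_mul (by norm_num)]
      exact (ENNReal.ofReal_lt_ofReal_iff (by positivity)).2 (by nlinarith)
    obtain ⟨hlow, hup⟩ := hreg x (a * r) (by positivity) hs
    refine setLIntegral_annulus_le_morreyNorm μ hA.le hp hq1.le hαQ hf ha0 hr ?_ ?_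
    · intro h0
      rw [h0, mul_zero, nonpos_iff_eq_zero, ENNReal.ofReal_eq_zero] at hlow
      exact absurd hlow (not_le.2 (by positivity))
    · rwa [ENNReal.ofReal_mul hA.le, ← hCA_eq]
  have hsum := (hasSum_geometric_of_lt_one hρ0.le hρ).mul_left (K * δ ^ β)
  calc _ ≤ ∫⁻ y in ⋃ k : ℕ, ball x (a * (a ^ k * δ)) \ ball x (a ^ k * δ),
        (‖f y‖₊ : ℝ≥0∞) / edist x y ^ (Q - α) ∂μ :=
        lintegral_mono_set (compl_ball_subset_iUnion_annuli x ha1 hδ)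
    _ ≤ _ := lintegral_iUnion_le _ _
    _ ≤ ∑' k : ℕ, ENNReal.ofReal (K * δ ^ β * (a ^ β) ^ k) * morreyNorm μ p q f :=
        ENNReal.tsum_le_tsum hannulus
    _ = _ := by
        rw [ENNReal.tsum_mul_right,
          ← ENNReal.ofReal_tsum_of_nonneg (fun k => by positivity) hsum.summable, hsum.tsum_eq]
        congr 2
        ring
end

section
/- Let (X,d,μ) be a metric measure space with a doubling measure μ and let 1 < p ≤ q ≤ ∞. Then there is a constant C > 0 such that for all f ∈ M_p^q(X), the Hardy–Littlewood maximal function satisfies ‖Mf‖_{M_p^q(X)} ≤ C ‖f‖_{M_p^q(X)}. -/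
open MeasureTheory Metric ENNReal Filter

/-- The Morrey norm for real-valued functions, with exponent `q ∈ [1,∞]`
(with the convention `1/∞ = 0`, implemented via `q.toReal⁻¹ = 0` when `q = ∞`). -/
noncomputable def morreyNormQ {X : Type*} [MetricSpace X] [MeasurableSpace X]
    (μ : Measure X) (p : ℝ) (q : ℝ≥0∞) (f : X → ℝ) : ℝ≥0∞ :=
  ⨆ (x : X) (r : ℝ) (_ : 0 < r),
    μ (ball x r) ^ (1 / q.toReal - 1 / p) *
      (∫⁻ y in ball x r, (‖f y‖₊ : ℝ≥0∞) ^ p ∂μ) ^ (1 / p)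

/-- The Morrey norm for `ℝ≥0∞`-valued functions, with exponent `q ∈ [1,∞]`. -/
noncomputable def morreyNormQE {X : Type*} [MetricSpace X] [MeasurableSpace X]
    (μ : Measure X) (p : ℝ) (q : ℝ≥0∞) (f : X → ℝ≥0∞) : ℝ≥0∞ :=
  ⨆ (x : X) (r : ℝ) (_ : 0 < r),
    μ (ball x r) ^ (1 / q.toReal - 1 / p) *
      (∫⁻ y in ball x r, (f y) ^ p ∂μ) ^ (1 / p)

/-- The Hardy–Littlewood maximal operator: supremum of averages over balls containing `x`. -/
noncomputable def maximalFn {X : Type*} [MetricSpace X] [MeasurableSpace X]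
    (μ : Measure X) (f : X → ℝ) (x : X) : ℝ≥0∞ :=
  ⨆ (z : X) (r : ℝ) (_ : 0 < r) (_ : x ∈ ball z r),
    (μ (ball z r))⁻¹ * ∫⁻ y in ball z r, (‖f y‖₊ : ℝ≥0∞) ∂μ

/-- The uncentred maximal operator over balls of radius at most `R`. -/
noncomputable def truncMaximal {X : Type*} [MetricSpace X] [MeasurableSpace X]
    (μ : Measure X) (R : ℝ) (g : X → ℝ≥0∞) (x : X) : ℝ≥0∞ :=
  ⨆ (z : X) (r : ℝ) (_ : 0 < r) (_ : r ≤ R) (_ : x ∈ ball z r),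
    (μ (ball z r))⁻¹ * ∫⁻ y in ball z r, g y ∂μ

/-- The Hölder inequality for averages. -/
lemma inv_measure_mul_setLIntegral_le {X : Type*} [MeasurableSpace X] {μ : Measure X}
    {s : Set X} (h0 : μ s ≠ 0) (h1 : μ s ≠ ⊤)
    {g : X → ℝ≥0∞} (hg : Measurable g) {p : ℝ} (hp : 1 < p) :
    (μ s)⁻¹ * ∫⁻ y in s, g y ∂μ ≤ μ s ^ (-(1 / p)) * (∫⁻ y in s, g y ^ p ∂μ) ^ (1 / p) := by
  have hpq := Real.HolderConjugate.conjExponent hp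
  have holder := ENNReal.lintegral_mul_le_Lp_mul_Lq (μ.restrict s) hpq hg.aemeasurable
    (aemeasurable_const (b := (1 : ℝ≥0∞)))
  have hexp : -(1 / p) = -1 + 1 / p.conjExponent := by
    have := hpq.inv_add_inv_eq_one
    simp only [one_div]; linarith
  simp only [Pi.mul_apply, mul_one, ENNReal.one_rpow, setLIntegral_one] at holder
  calc (μ s)⁻¹ * ∫⁻ y in s, g y ∂μ
      ≤ (μ s)⁻¹ * ((∫⁻ y in s, g y ^ p ∂μ) ^ (1 / p) * μ s ^ (1 / p.conjExponent)) := by gcongr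
    _ = μ s ^ (-(1 / p)) * (∫⁻ y in s, g y ^ p ∂μ) ^ (1 / p) := by
      rw [hexp, ENNReal.rpow_add _ _ h0 h1, ENNReal.rpow_neg_one]; ring

section Doubling

variable {X : Type*} [MetricSpace X] [MeasurableSpace X] {μ : Measure X} {C₀ : ℝ≥0∞}

lemma measure_ball_two_pow_mul_le
    (hdb : ∀ (x : X) (r : ℝ), 0 < r → μ (ball x (2 * r)) ≤ C₀ * μ (ball x r))
    (x : X) {r : ℝ} (hr : 0 < r) (n : ℕ) :
    μ (ball x (2 ^ n * r)) ≤ C₀ ^ n * μ (ball x r) := by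
  induction n with
  | zero => simp
  | succ n ih =>
    calc μ (ball x (2 ^ (n + 1) * r)) = μ (ball x (2 * (2 ^ n * r))) := by
          rw [pow_succ']; ring_nf
      _ ≤ C₀ * μ (ball x (2 ^ n * r)) := hdb x _ (by positivity)
      _ ≤ C₀ * (C₀ ^ n * μ (ball x r)) := by gcongr
      _ = C₀ ^ (n + 1) * μ (ball x r) := by rw [pow_succ', mul_assoc]

/-- If one ball is small up to the doubling constant, so is every ball around the same centre. -/
lemma exists_measure_ball_le_pow_mul
    (hdb : ∀ (x : X) (r : ℝ), 0 < r → μ (ball x (2 * r)) ≤ C₀ * μ (ball x r))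
    (x y : X) {r : ℝ} (hr : 0 < r) (s : ℝ) :
    ∃ n : ℕ, μ (ball y s) ≤ C₀ ^ n * μ (ball x r) := by
  obtain ⟨n, hn⟩ := pow_unbounded_of_one_lt ((s + dist y x) / r) (one_lt_two (α := ℝ))
  refine ⟨n, (measure_mono (ball_subset_ball' ?_)).trans (measure_ball_two_pow_mul_le hdb x hr n)⟩
  exact ((div_lt_iff₀ hr).1 hn).le

lemma sigmaFinite_of_measure_ball_ne_top (hfin : ∀ (x : X) (r : ℝ), μ (ball x r) ≠ ⊤) :
    SigmaFinite μ := by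
  rcases isEmpty_or_nonempty X with h | ⟨⟨x⟩⟩
  · rw [μ.eq_zero_of_isEmpty]; infer_instance
  · exact ⟨⟨⟨fun n : ℕ => ball x n, fun _ => trivial, fun n => (hfin x n).lt_top,
      iUnion_ball_nat x⟩⟩⟩

lemma lt_truncMaximal_iff {R : ℝ} {g : X → ℝ≥0∞} {x : X} {t : ℝ≥0∞} :
    t < truncMaximal μ R g x ↔ ∃ (z : X) (r : ℝ), 0 < r ∧ r ≤ R ∧ x ∈ ball z r ∧
      t < (μ (ball z r))⁻¹ * ∫⁻ y in ball z r, g y ∂μ := by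
  simp only [truncMaximal, lt_iSup_iff, exists_prop]

lemma le_morreyNormQ (p : ℝ) (q : ℝ≥0∞) (f : X → ℝ) (x : X) {r : ℝ} (hr : 0 < r) :
    μ (ball x r) ^ (1 / q.toReal - 1 / p) *
      (∫⁻ y in ball x r, (‖f y‖₊ : ℝ≥0∞) ^ p ∂μ) ^ (1 / p) ≤ morreyNormQ μ p q f :=
  le_iSup_of_le x (le_iSup_of_le r (le_iSup_of_le hr le_rfl))

lemma morreyNormQE_zero {p : ℝ} (hp : 0 < p) (q : ℝ≥0∞) {g : X → ℝ≥0∞}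
    (hg : ∀ x r, 0 < r → ∫⁻ y in ball x r, g y ^ p ∂μ = 0) : morreyNormQE μ p q g = 0 := by
  simp only [morreyNormQE, ENNReal.iSup_eq_zero]
  intro x r hr
  rw [hg x r hr, ENNReal.zero_rpow_of_pos (by positivity), mul_zero]

lemma maximalFn_eq_zero_of_measure_ball_eq_top
    (h : ∀ (x : X) (r : ℝ), 0 < r → μ (ball x r) = ⊤) (f : X → ℝ) (x : X) :
    maximalFn μ f x = 0 := by
  simp only [maximalFn, ENNReal.iSup_eq_zero]
  intro z r hr _
  rw [h z r hr, ENNReal.inv_top, zero_mul]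

variable [BorelSpace X]

lemma measurable_truncMaximal (R : ℝ) (g : X → ℝ≥0∞) : Measurable (truncMaximal μ R g) := by
  refine measurable_of_Ioi fun t => IsOpen.measurableSet (isOpen_iff.2 ?_)
  intro x hx
  obtain ⟨z, r, hr, hrR, hxz, ht⟩ := lt_truncMaximal_iff.1 hx
  obtain ⟨ε, hε, hsub⟩ := isOpen_iff.1 isOpen_ball x hxz
  exact ⟨ε, hε, fun y hy => lt_truncMaximal_iff.2 ⟨z, r, hr, hrR, hsub hy, ht⟩⟩

/-- Weak type `(1, 1)` estimate, by the Vitali covering lemma. -/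
lemma mul_measure_lt_truncMaximal_le
    (hdb : ∀ (x : X) (r : ℝ), 0 < r → μ (ball x (2 * r)) ≤ C₀ * μ (ball x r))
    (hpos : ∀ (x : X) (r : ℝ), 0 < r → μ (ball x r) ≠ 0)
    (hfin : ∀ (x : X) (r : ℝ), μ (ball x r) ≠ ⊤)
    (R : ℝ) (g : X → ℝ≥0∞) (t : ℝ≥0∞) :
    t * μ {x | t < truncMaximal μ R g x} ≤ C₀ ^ 3 * ∫⁻ x, g x ∂μ := by
  have := sigmaFinite_of_measure_ball_ne_top hfin
  let T : Set (X × ℝ) := {a | 0 < a.2 ∧ a.2 ≤ R ∧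
    t < (μ (ball a.1 a.2))⁻¹ * ∫⁻ y in ball a.1 a.2, g y ∂μ}
  obtain ⟨u, huT, hdisj, hcov⟩ := Vitali.exists_disjoint_subfamily_covering_enlargement_closedBall
    T Prod.fst Prod.snd R (fun a ha => ha.2.1) 5 (by norm_num)
  have hdisj' : u.PairwiseDisjoint fun a => ball a.1 a.2 :=
    hdisj.mono fun a => ball_subset_closedBall
  have hu : u.Countable := by
    have h := Measure.countable_meas_pos_of_disjoint_iUnion (μ := μ)
      (As := fun a : u => ball a.1.1 a.1.2) (fun _ => measurableSet_ball)
      (fun a b hab => hdisj' a.2 b.2 (fun h => hab (Subtype.ext h)))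
    have huniv : {a : u | 0 < μ (ball a.1.1 a.1.2)} = Set.univ :=
      Set.eq_univ_of_forall fun a => (hpos _ _ (huT a.2).1).bot_lt
    rw [huniv, Set.countable_univ_iff] at h
    exact Set.countable_coe_iff.1 h
  have hsub : {x | t < truncMaximal μ R g x} ⊆ ⋃ a ∈ u, ball a.1 (2 ^ 3 * a.2) := by
    intro x hx
    obtain ⟨z, r, hr, hrR, hxz, ht⟩ := lt_truncMaximal_iff.1 hx
    obtain ⟨b, hb, hzb⟩ := hcov (z, r) ⟨hr, hrR, ht⟩
    refine Set.mem_biUnion hb (closedBall_subset_ball ?_ (hzb (ball_subset_closedBall hxz)))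
    linarith [(huT hb).1]
  calc t * μ {x | t < truncMaximal μ R g x}
      ≤ t * ∑' a : u, μ (ball a.1.1 (2 ^ 3 * a.1.2)) := by
        gcongr; exact (measure_mono hsub).trans (measure_biUnion_le μ hu _)
    _ = ∑' a : u, t * μ (ball a.1.1 (2 ^ 3 * a.1.2)) := ENNReal.tsum_mul_left.symm
    _ ≤ ∑' a : u, C₀ ^ 3 * ∫⁻ y in ball a.1.1 a.1.2, g y ∂μ := by
        refine ENNReal.tsum_le_tsum fun a => ?_
        obtain ⟨hr, -, ht⟩ := huT a.2
        calc t * μ (ball a.1.1 (2 ^ 3 * a.1.2))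
            ≤ t * (C₀ ^ 3 * μ (ball a.1.1 a.1.2)) := by
              gcongr; exact measure_ball_two_pow_mul_le hdb _ hr 3
          _ = C₀ ^ 3 * (t * μ (ball a.1.1 a.1.2)) := by ring
          _ ≤ C₀ ^ 3 * ∫⁻ y in ball a.1.1 a.1.2, g y ∂μ := by
              gcongr
              rw [mul_comm] at ht
              exact (ENNReal.lt_div_iff_mul_lt (Or.inl (hpos _ _ hr)) (Or.inl (hfin _ _))).1
                ht |>.le
    _ = C₀ ^ 3 * ∫⁻ y in ⋃ a ∈ u, ball a.1 a.2, g y ∂μ := by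
        rw [ENNReal.tsum_mul_left, lintegral_biUnion hu (fun _ _ => measurableSet_ball) hdisj']
    _ ≤ C₀ ^ 3 * ∫⁻ x, g x ∂μ := by gcongr; exact Measure.restrict_le_self

/-- The weak type estimate localised to the set where `g` is large. -/
lemma mul_measure_lt_truncMaximal_le_setLIntegral
    (hdb : ∀ (x : X) (r : ℝ), 0 < r → μ (ball x (2 * r)) ≤ C₀ * μ (ball x r))
    (hpos : ∀ (x : X) (r : ℝ), 0 < r → μ (ball x r) ≠ 0)
    (hfin : ∀ (x : X) (r : ℝ), μ (ball x r) ≠ ⊤)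
    (R : ℝ) {g : X → ℝ≥0∞} (hg : Measurable g) (t : ℝ≥0∞) :
    2 * t * μ {x | 2 * t < truncMaximal μ R g x} ≤
      2 * C₀ ^ 3 * ∫⁻ x in {x | t < g x}, g x ∂μ := by
  have hS : MeasurableSet {x | t < g x} := measurableSet_lt measurable_const hg
  have hsub : {x | 2 * t < truncMaximal μ R g x} ⊆
      {x | t < truncMaximal μ R ({x | t < g x}.indicator g) x} := by
    intro x hx
    obtain ⟨z, r, hr, hrR, hxz, h⟩ := lt_truncMaximal_iff.1 hx
    refine lt_truncMaximal_iff.2 ⟨z, r, hr, hrR, hxz, ?_⟩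
    have hle : ∫⁻ y in ball z r, g y ∂μ ≤
        ∫⁻ y in ball z r, {x | t < g x}.indicator g y ∂μ + t * μ (ball z r) := by
      rw [← setLIntegral_const, ← lintegral_add_right _ measurable_const]
      refine lintegral_mono fun y => ?_
      by_cases hy : t < g y
      · simp [Set.indicator, hy]
      · simpa [Set.indicator, hy] using not_lt.1 hy
    have h2 : t + t < (μ (ball z r))⁻¹ * ∫⁻ y in ball z r, {x | t < g x}.indicator g y ∂μ + t := by
      rw [← two_mul]
      refine h.trans_le ?_
      calc _ ≤ (μ (ball z r))⁻¹ *
            (∫⁻ y in ball z r, {x | t < g x}.indicator g y ∂μ + t * μ (ball z r)) := by gcongr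
        _ = _ := by
          rw [mul_add, mul_comm t, ← mul_assoc, ENNReal.inv_mul_cancel (hpos z r hr) (hfin z r),
            one_mul]
    exact lt_of_add_lt_add_right h2
  calc _ ≤ 2 * (t * μ {x | t < truncMaximal μ R ({x | t < g x}.indicator g) x}) := by
        rw [mul_assoc]; gcongr
    _ ≤ 2 * (C₀ ^ 3 * ∫⁻ x, {x | t < g x}.indicator g x ∂μ) := by
        exact mul_le_mul' le_rfl (mul_measure_lt_truncMaximal_le hdb hpos hfin R _ t)
    _ = _ := by rw [lintegral_indicator hS, mul_assoc]

lemma ae_truncMaximal_ne_top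
    (hdb : ∀ (x : X) (r : ℝ), 0 < r → μ (ball x (2 * r)) ≤ C₀ * μ (ball x r))
    (hpos : ∀ (x : X) (r : ℝ), 0 < r → μ (ball x r) ≠ 0)
    (hfin : ∀ (x : X) (r : ℝ), μ (ball x r) ≠ ⊤) (hC₀ : C₀ ≠ ⊤)
    (R : ℝ) {g : X → ℝ≥0∞} (hg : Measurable g) {p : ℝ} (hp : 1 ≤ p)
    (hgp : ∫⁻ x, g x ^ p ∂μ ≠ ⊤) : ∀ᵐ x ∂μ, truncMaximal μ R g x ≠ ⊤ := by
  have key (n : ℕ) : (n : ℝ≥0∞) * μ {x | truncMaximal μ R g x = ⊤} ≤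
      2 * C₀ ^ 3 * ∫⁻ x, g x ^ p ∂μ := by
    have hn : ((n + 1 : ℕ) : ℝ≥0∞) ≠ ⊤ := ENNReal.natCast_ne_top _
    calc (n : ℝ≥0∞) * μ {x | truncMaximal μ R g x = ⊤}
        ≤ 2 * ((n + 1 : ℕ) : ℝ≥0∞) * μ {x | 2 * ((n + 1 : ℕ) : ℝ≥0∞) < truncMaximal μ R g x} := by
          gcongr ?_ * μ ?_
          · norm_cast; omega
          · intro x hx
            rw [Set.mem_ofPred_eq] at hx ⊢
            rw [hx]
            exact ENNReal.mul_lt_top (by simp) hn.lt_top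
      _ ≤ 2 * C₀ ^ 3 * ∫⁻ x in {x | ((n + 1 : ℕ) : ℝ≥0∞) < g x}, g x ∂μ :=
          mul_measure_lt_truncMaximal_le_setLIntegral hdb hpos hfin R hg _
      _ ≤ 2 * C₀ ^ 3 * ∫⁻ x in {x | ((n + 1 : ℕ) : ℝ≥0∞) < g x}, g x ^ p ∂μ := by
          refine mul_le_mul' le_rfl (setLIntegral_mono (by fun_prop) fun x hx => ?_)
          have h1 : 1 ≤ g x := le_trans (by norm_cast; omega) (le_of_lt hx)
          simpa using ENNReal.rpow_le_rpow_of_exponent_le h1 hp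
      _ ≤ _ := by gcongr; exact Measure.restrict_le_self
  have hfin' : 2 * C₀ ^ 3 * ∫⁻ x, g x ^ p ∂μ ≠ ⊤ := by finiteness
  rw [ae_iff]
  simp only [ne_eq, not_not]
  by_contra h0
  obtain ⟨n, hn⟩ := ENNReal.exists_nat_mul_gt h0 hfin'
  exact (key n).not_gt hn

/-- Strong type `(p, p)` estimate for the truncated maximal operator. -/
lemma lintegral_truncMaximal_rpow_le
    (hdb : ∀ (x : X) (r : ℝ), 0 < r → μ (ball x (2 * r)) ≤ C₀ * μ (ball x r))
    (hpos : ∀ (x : X) (r : ℝ), 0 < r → μ (ball x r) ≠ 0)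
    (hfin : ∀ (x : X) (r : ℝ), μ (ball x r) ≠ ⊤) (hC₀ : C₀ ≠ ⊤)
    (R : ℝ) {G : X → ℝ} (hG : Measurable G) (hG0 : 0 ≤ G) {p : ℝ} (hp : 1 < p)
    (hGp : ∫⁻ x, ENNReal.ofReal (G x) ^ p ∂μ ≠ ⊤) :
    ∫⁻ x, truncMaximal μ R (fun y => ENNReal.ofReal (G y)) x ^ p ∂μ ≤
      ENNReal.ofReal p * (2 * C₀ ^ 3) * ((ENNReal.ofReal (p - 1))⁻¹ * 2 ^ (p - 1)) *
        ∫⁻ x, ENNReal.ofReal (G x) ^ p ∂μ := by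
  set g : X → ℝ≥0∞ := fun y => ENNReal.ofReal (G y) with hgdef
  have hg : Measurable g := by fun_prop
  have hM : Measurable (truncMaximal μ R g) := measurable_truncMaximal R g
  set F : X → ℝ := fun x => (truncMaximal μ R g x).toReal with hFdef
  set ν : Measure X := μ.withDensity g with hν
  have hp0 : 0 < p := by linarith
  have hp1 : 0 < p - 1 := by linarith
  have hlayer : ENNReal.ofReal (p - 1) *
      ∫⁻ t in Set.Ioi (0 : ℝ), ν {x | t < 2 * G x} * ENNReal.ofReal (t ^ (p - 1 - 1)) =
      2 ^ (p - 1) * ∫⁻ x, g x ^ p ∂μ := by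
    rw [← lintegral_rpow_eq_lintegral_meas_lt_mul ν
      (Eventually.of_forall fun x => mul_nonneg zero_le_two (hG0 x)) (by fun_prop) hp1,
      hν, lintegral_withDensity_eq_lintegral_mul μ hg (by fun_prop),
      ← lintegral_const_mul _ (by fun_prop)]
    refine lintegral_congr fun x => ?_
    have hx : 0 ≤ G x := hG0 x
    have h2 : (2 : ℝ≥0∞) = ENNReal.ofReal 2 := by simp
    simp only [Pi.mul_apply, hgdef]
    rw [h2, ENNReal.ofReal_rpow_of_nonneg zero_le_two hp1.le, ENNReal.ofReal_rpow_of_nonneg hx hp0.le,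
      ← ENNReal.ofReal_mul hx, ← ENNReal.ofReal_mul (by positivity), Real.mul_rpow zero_le_two hx,
      show G x ^ p = G x ^ (p - 1) * G x by
        rw [← Real.rpow_add_one' hx (by linarith), sub_add_cancel]]
    congr 1; ring
  have hlayer' : ∫⁻ t in Set.Ioi (0 : ℝ), ν {x | t < 2 * G x} * ENNReal.ofReal (t ^ (p - 1 - 1)) =
      (ENNReal.ofReal (p - 1))⁻¹ * 2 ^ (p - 1) * ∫⁻ x, g x ^ p ∂μ := by
    rw [mul_assoc, ← hlayer, ← mul_assoc, ENNReal.inv_mul_cancel (by simpa using hp1) (by simp),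
      one_mul]
  calc ∫⁻ x, truncMaximal μ R g x ^ p ∂μ = ∫⁻ x, ENNReal.ofReal (F x ^ p) ∂μ := by
        refine lintegral_congr_ae ?_
        filter_upwards [ae_truncMaximal_ne_top hdb hpos hfin hC₀ R hg hp.le hGp] with x hx
        rw [← ENNReal.ofReal_rpow_of_nonneg ENNReal.toReal_nonneg hp0.le, ENNReal.ofReal_toReal hx]
    _ = ENNReal.ofReal p *
          ∫⁻ t in Set.Ioi (0 : ℝ), μ {x | t < F x} * ENNReal.ofReal (t ^ (p - 1)) :=
        lintegral_rpow_eq_lintegral_meas_lt_mul μ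
          (Eventually.of_forall fun x => ENNReal.toReal_nonneg) (by fun_prop) hp0
    _ ≤ ENNReal.ofReal p * ∫⁻ t in Set.Ioi (0 : ℝ),
          2 * C₀ ^ 3 * (ν {x | t < 2 * G x} * ENNReal.ofReal (t ^ (p - 1 - 1))) := by
        refine mul_le_mul' le_rfl (setLIntegral_mono' measurableSet_Ioi fun t (ht : 0 < t) => ?_)
        have htt : 2 * ENNReal.ofReal (t / 2) = ENNReal.ofReal t := by
          rw [show (2 : ℝ≥0∞) = ENNReal.ofReal 2 by simp, ← ENNReal.ofReal_mul zero_le_two]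
          congr 1; ring
        have hset : {x | ENNReal.ofReal (t / 2) < g x} = {x | t < 2 * G x} := by
          ext x
          simp only [Set.mem_ofPred_eq, hgdef]
          rw [ENNReal.ofReal_lt_ofReal_iff_of_nonneg (by positivity), div_lt_iff₀' two_pos]
        have hweak := mul_measure_lt_truncMaximal_le_setLIntegral hdb hpos hfin R hg
          (ENNReal.ofReal (t / 2))
        rw [htt, hset, ← withDensity_apply g (measurableSet_lt (by fun_prop) (by fun_prop))]
          at hweak
        have hpow : ENNReal.ofReal (t ^ (p - 1)) =
            ENNReal.ofReal t * ENNReal.ofReal (t ^ (p - 1 - 1)) := by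
          rw [← ENNReal.ofReal_mul ht.le, Real.rpow_sub_one ht.ne' (p - 1),
            mul_div_cancel₀ _ ht.ne']
        calc μ {x | t < F x} * ENNReal.ofReal (t ^ (p - 1))
            = ENNReal.ofReal t * μ {x | t < F x} * ENNReal.ofReal (t ^ (p - 1 - 1)) := by
              rw [hpow]; ring
          _ ≤ ENNReal.ofReal t * μ {x | ENNReal.ofReal t < truncMaximal μ R g x} *
                ENNReal.ofReal (t ^ (p - 1 - 1)) := by
              gcongr with x
              exact fun h => (ENNReal.ofReal_lt_ofReal_iff_of_nonneg ht.le).2 h |>.trans_le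
                ENNReal.ofReal_toReal_le
          _ ≤ 2 * C₀ ^ 3 * ν {x | t < 2 * G x} * ENNReal.ofReal (t ^ (p - 1 - 1)) := by
              gcongr
          _ = _ := by rw [mul_assoc]
    _ = _ := by
        rw [lintegral_const_mul' _ _ (by finiteness), hlayer']
        ring

/-- On a ball, averages over small balls only see `f` on a fixed dilate, and averages over large
balls are controlled by the Morrey norm. -/
lemma maximalFn_le_truncMaximal_add
    (hdb : ∀ (x : X) (r : ℝ), 0 < r → μ (ball x (2 * r)) ≤ C₀ * μ (ball x r))
    (hpos : ∀ (x : X) (r : ℝ), 0 < r → μ (ball x r) ≠ 0)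
    (hfin : ∀ (x : X) (r : ℝ), μ (ball x r) ≠ ⊤)
    {p : ℝ} (hp : 1 < p) (q : ℝ≥0∞) {f : X → ℝ} (hf : Measurable f)
    {x y : X} {r : ℝ} (hr : 0 < r) (hy : y ∈ ball x r) :
    maximalFn μ f y ≤
      truncMaximal μ r
        (fun w => ENNReal.ofReal ((ball x (2 ^ 2 * r)).indicator (fun w => ‖f w‖) w)) y +
      (C₀ ^ 2) ^ (1 / q.toReal) * μ (ball x r) ^ (-(1 / q.toReal)) * morreyNormQ μ p q f := by
  refine iSup_le fun z => iSup_le fun s => iSup_le fun hs => iSup_le fun hyz => ?_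
  have hyx : dist y x < r := hy
  have hyz' : dist y z < s := hyz
  rcases le_or_gt s r with hsr | hrs
  · refine le_add_right ?_
    have hsub : ball z s ⊆ ball x (2 ^ 2 * r) := by
      refine ball_subset_ball' ?_
      linarith [dist_triangle_left z x y]
    have heq : ∫⁻ w in ball z s, (‖f w‖₊ : ℝ≥0∞) ∂μ = ∫⁻ w in ball z s,
        ENNReal.ofReal ((ball x (2 ^ 2 * r)).indicator (fun w => ‖f w‖) w) ∂μ := by
      refine setLIntegral_congr_fun measurableSet_ball fun w hw => ?_
      rw [Set.indicator_of_mem (hsub hw), ofReal_norm]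
      rfl
    rw [heq]
    exact le_iSup_of_le z (le_iSup_of_le s (le_iSup_of_le hs (le_iSup_of_le hsr
      (le_iSup_of_le hyz le_rfl))))
  · refine le_add_left ?_
    have hb : 0 ≤ 1 / q.toReal := by positivity
    have hsub : ball x r ⊆ ball z (2 ^ 2 * s) := by
      refine ball_subset_ball' ?_
      linarith [dist_triangle_left x z y]
    have hmeas : μ (ball x r) ≤ C₀ ^ 2 * μ (ball z s) :=
      (measure_mono hsub).trans (measure_ball_two_pow_mul_le hdb z hs 2)
    have hmeas' : μ (ball z s) ^ (-(1 / q.toReal)) ≤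
        (C₀ ^ 2) ^ (1 / q.toReal) * μ (ball x r) ^ (-(1 / q.toReal)) := by
      have h := ENNReal.rpow_le_rpow hmeas hb
      rw [ENNReal.mul_rpow_of_nonneg _ _ hb] at h
      rw [ENNReal.rpow_neg, ENNReal.rpow_neg, ← div_eq_mul_inv,
        ENNReal.le_div_iff_mul_le (Or.inl (by simp [hpos x r hr, hfin x r]))
          (Or.inl (ENNReal.rpow_ne_top_of_nonneg hb (hfin x r)))]
      calc _ ≤ (μ (ball z s) ^ (1 / q.toReal))⁻¹ *
            ((C₀ ^ 2) ^ (1 / q.toReal) * μ (ball z s) ^ (1 / q.toReal)) := by gcongr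
        _ = (C₀ ^ 2) ^ (1 / q.toReal) *
            ((μ (ball z s) ^ (1 / q.toReal))⁻¹ * μ (ball z s) ^ (1 / q.toReal)) := by ring
        _ ≤ (C₀ ^ 2) ^ (1 / q.toReal) * 1 := by gcongr; exact ENNReal.inv_mul_le_one _
        _ = _ := mul_one _
    calc (μ (ball z s))⁻¹ * ∫⁻ w in ball z s, (‖f w‖₊ : ℝ≥0∞) ∂μ
        ≤ μ (ball z s) ^ (-(1 / p)) *
            (∫⁻ w in ball z s, (‖f w‖₊ : ℝ≥0∞) ^ p ∂μ) ^ (1 / p) :=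
          inv_measure_mul_setLIntegral_le (hpos z s hs) (hfin z s) (by fun_prop) hp
      _ = μ (ball z s) ^ (-(1 / q.toReal)) * (μ (ball z s) ^ (1 / q.toReal - 1 / p) *
            (∫⁻ w in ball z s, (‖f w‖₊ : ℝ≥0∞) ^ p ∂μ) ^ (1 / p)) := by
          rw [← mul_assoc, ← ENNReal.rpow_add _ _ (hpos z s hs) (hfin z s)]
          congr 2; ring
      _ ≤ _ := by gcongr; exact le_morreyNormQ p q f z hs

lemma morreyNormQE_maximalFn_le
    (hdb : ∀ (x : X) (r : ℝ), 0 < r → μ (ball x (2 * r)) ≤ C₀ * μ (ball x r))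
    (hpos : ∀ (x : X) (r : ℝ), 0 < r → μ (ball x r) ≠ 0)
    (hfin : ∀ (x : X) (r : ℝ), μ (ball x r) ≠ ⊤) (hC₀ : C₀ ≠ ⊤)
    {p : ℝ} (hp : 1 < p) {q : ℝ≥0∞} (hpq : 1 / q.toReal ≤ 1 / p)
    {f : X → ℝ} (hf : Measurable f) (hN : morreyNormQ μ p q f ≠ ⊤) :
    morreyNormQE μ p q (maximalFn μ f) ≤
      2 * ((ENNReal.ofReal p * (2 * C₀ ^ 3) * ((ENNReal.ofReal (p - 1))⁻¹ * 2 ^ (p - 1))) ^ (1 / p)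
        * (C₀ ^ 2) ^ (1 / p - 1 / q.toReal) + (C₀ ^ 2) ^ (1 / q.toReal)) *
      morreyNormQ μ p q f := by
  refine iSup_le fun x => iSup_le fun r => iSup_le fun hr => ?_
  set A := ENNReal.ofReal p * (2 * C₀ ^ 3) * ((ENNReal.ofReal (p - 1))⁻¹ * 2 ^ (p - 1))
  set N := morreyNormQ μ p q f
  set b := 1 / q.toReal
  set m := μ (ball x r)
  set D := ball x (2 ^ 2 * r)
  set G : X → ℝ := D.indicator (fun w => ‖f w‖)
  set M := truncMaximal μ r (fun w => ENNReal.ofReal (G w))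
  set K := (C₀ ^ 2) ^ b * m ^ (-b) * N
  have hp0 : 0 < p := by linarith
  have ha : 0 ≤ 1 / p - b := by linarith
  have hm0 : m ≠ 0 := hpos x r hr
  have hm1 : m ≠ ⊤ := hfin x r
  have hr' : 0 < 2 ^ 2 * r := by positivity
  have hD0 : μ D ≠ 0 := hpos x _ hr'
  have hD1 : μ D ≠ ⊤ := hfin x _
  have hGint : ∫⁻ w, ENNReal.ofReal (G w) ^ p ∂μ = ∫⁻ w in D, (‖f w‖₊ : ℝ≥0∞) ^ p ∂μ := by
    rw [← lintegral_indicator measurableSet_ball]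
    refine lintegral_congr fun w => ?_
    by_cases hw : w ∈ D
    · rw [Set.indicator_of_mem hw]; simp only [G, Set.indicator_of_mem hw, ofReal_norm]; rfl
    · rw [Set.indicator_of_notMem hw]; simp [G, Set.indicator_of_notMem hw, hp0]
  have hGnorm : (∫⁻ w, ENNReal.ofReal (G w) ^ p ∂μ) ^ (1 / p) ≤
      (C₀ ^ 2) ^ (1 / p - b) * m ^ (1 / p - b) * N := by
    rw [hGint]
    calc (∫⁻ w in D, (‖f w‖₊ : ℝ≥0∞) ^ p ∂μ) ^ (1 / p)
        = μ D ^ (1 / p - b) * (μ D ^ (b - 1 / p) *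
            (∫⁻ w in D, (‖f w‖₊ : ℝ≥0∞) ^ p ∂μ) ^ (1 / p)) := by
          rw [← mul_assoc, ← ENNReal.rpow_add _ _ hD0 hD1, sub_add_sub_cancel, sub_self,
            ENNReal.rpow_zero, one_mul]
      _ ≤ (C₀ ^ 2 * m) ^ (1 / p - b) * N := by
          gcongr
          · exact measure_ball_two_pow_mul_le hdb x hr 2
          · exact le_morreyNormQ p q f x hr'
      _ = _ := by rw [ENNReal.mul_rpow_of_nonneg _ _ ha]
  have hGfin : ∫⁻ w, ENNReal.ofReal (G w) ^ p ∂μ ≠ ⊤ := by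
    intro h
    rw [h, ENNReal.top_rpow_of_pos (by positivity), top_le_iff] at hGnorm
    have h1 : (C₀ ^ 2) ^ (1 / p - b) ≠ ⊤ := ENNReal.rpow_ne_top_of_nonneg ha (by finiteness)
    have h2 : m ^ (1 / p - b) ≠ ⊤ := ENNReal.rpow_ne_top_of_nonneg ha hm1
    exact ENNReal.mul_ne_top (ENNReal.mul_ne_top h1 h2) hN hGnorm
  have hG : Measurable G := hf.norm.indicator measurableSet_ball
  have hG0 : 0 ≤ G := fun w => Set.indicator_nonneg (fun _ _ => norm_nonneg _) w
  have hstrong : ∫⁻ w, M w ^ p ∂μ ≤ A * ∫⁻ w, ENNReal.ofReal (G w) ^ p ∂μ :=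
    lintegral_truncMaximal_rpow_le hdb hpos hfin hC₀ r hG hG0 hp hGfin
  have hLp : (∫⁻ w in ball x r, maximalFn μ f w ^ p ∂μ) ^ (1 / p) ≤
      2 * (A ^ (1 / p) * ((C₀ ^ 2) ^ (1 / p - b) * m ^ (1 / p - b) * N) + K * m ^ (1 / p)) := by
    have hptw : ∀ w ∈ ball x r, maximalFn μ f w ^ p ≤ 2 ^ p * (M w ^ p + K ^ p) := by
      intro w hw
      have h := maximalFn_le_truncMaximal_add hdb hpos hfin hp q hf hr hw
      calc maximalFn μ f w ^ p ≤ (2 * max (M w) K) ^ p := by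
            gcongr
            refine h.trans ?_
            rw [two_mul]
            exact add_le_add (le_max_left _ _) (le_max_right _ _)
        _ = 2 ^ p * max (M w) K ^ p := ENNReal.mul_rpow_of_nonneg _ _ hp0.le
        _ ≤ _ := by
            gcongr
            rcases max_cases (M w) K with ⟨h, -⟩ | ⟨h, -⟩ <;> rw [h]
            · exact le_self_add
            · exact le_add_self
    calc (∫⁻ w in ball x r, maximalFn μ f w ^ p ∂μ) ^ (1 / p)
        ≤ (∫⁻ w in ball x r, 2 ^ p * (M w ^ p + K ^ p) ∂μ) ^ (1 / p) := by
          gcongr ?_ ^ (1 / p)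
          exact setLIntegral_mono' measurableSet_ball hptw
      _ = (2 ^ p * (∫⁻ w in ball x r, M w ^ p ∂μ + K ^ p * m)) ^ (1 / p) := by
          rw [lintegral_const_mul' _ _ (by finiteness), lintegral_add_right _ measurable_const,
            setLIntegral_const]
      _ ≤ (2 ^ p * (A * ∫⁻ w, ENNReal.ofReal (G w) ^ p ∂μ + K ^ p * m)) ^ (1 / p) := by
          gcongr
          exact (setLIntegral_le_lintegral _ _).trans hstrong
      _ ≤ 2 * ((A * ∫⁻ w, ENNReal.ofReal (G w) ^ p ∂μ) ^ (1 / p) + (K ^ p * m) ^ (1 / p)) := by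
          rw [ENNReal.mul_rpow_of_nonneg _ _ (by positivity), one_div, ENNReal.rpow_rpow_inv hp0.ne']
          gcongr
          exact ENNReal.rpow_add_le_add_rpow _ _ (by positivity) (inv_le_one_of_one_le₀ hp.le)
      _ ≤ _ := by
          rw [ENNReal.mul_rpow_of_nonneg _ _ (by positivity),
            ENNReal.mul_rpow_of_nonneg (K ^ p) _ (by positivity), one_div,
            ENNReal.rpow_rpow_inv hp0.ne', ← one_div]
          gcongr
  calc m ^ (b - 1 / p) * (∫⁻ w in ball x r, maximalFn μ f w ^ p ∂μ) ^ (1 / p)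
      ≤ m ^ (b - 1 / p) * (2 * (A ^ (1 / p) * ((C₀ ^ 2) ^ (1 / p - b) * m ^ (1 / p - b) * N) +
          K * m ^ (1 / p))) := by gcongr
    _ = 2 * (A ^ (1 / p) * (C₀ ^ 2) ^ (1 / p - b) * (m ^ (b - 1 / p) * m ^ (1 / p - b)) +
          (C₀ ^ 2) ^ b * (m ^ (b - 1 / p) * m ^ (-b) * m ^ (1 / p))) * N := by
        simp only [K]; ring
    _ = _ := by
        rw [← ENNReal.rpow_add _ _ hm0 hm1, ← ENNReal.rpow_add _ _ hm0 hm1,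
          ← ENNReal.rpow_add _ _ hm0 hm1, show b - 1 / p + (1 / p - b) = 0 by ring,
          show b - 1 / p + -b + 1 / p = 0 by ring, ENNReal.rpow_zero, mul_one, mul_one]

end Doubling

theorem stmt7 {X : Type*} [MetricSpace X] [MeasurableSpace X] [BorelSpace X]
    (μ : Measure X)
    (C₀ : ℝ≥0∞) (hC₀ : 1 ≤ C₀) (hC₀' : C₀ < ⊤)
    (hdb : ∀ (x : X) (r : ℝ), 0 < r → μ (ball x (2 * r)) ≤ C₀ * μ (ball x r))
    (p : ℝ) (q : ℝ≥0∞) (hp : 1 < p) (hpq : ENNReal.ofReal p ≤ q) :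
    ∃ C : ℝ, 0 < C ∧
      ∀ f : X → ℝ, Measurable f → morreyNormQ μ p q f < ⊤ →
        morreyNormQE μ p q (maximalFn μ f) ≤ ENNReal.ofReal C * morreyNormQ μ p q f := by
  have hp0 : 0 < p := by linarith
  have hC : C₀ ≠ ⊤ := hC₀'.ne
  have hexp : 1 / q.toReal ≤ 1 / p := by
    rcases eq_or_ne q ⊤ with rfl | hq
    · simp [hp0.le]
    · exact one_div_le_one_div_of_le hp0 ((ENNReal.ofReal_le_iff_le_toReal hq).1 hpq)
  by_cases hzero : ∃ (x : X) (r : ℝ), 0 < r ∧ μ (ball x r) = 0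
  · obtain ⟨x, r, hr, h0⟩ := hzero
    refine ⟨1, one_pos, fun f _ _ => ?_⟩
    rw [morreyNormQE_zero hp0]
    · exact zero_le
    · intro y s _
      obtain ⟨n, hn⟩ := exists_measure_ball_le_pow_mul hdb x y hr s
      rw [h0, mul_zero] at hn
      exact setLIntegral_measure_zero _ _ (le_antisymm hn zero_le)
  by_cases htop : ∃ (x : X) (r : ℝ), μ (ball x r) = ⊤
  · obtain ⟨x, r, htop⟩ := htop
    have hall : ∀ (y : X) (s : ℝ), 0 < s → μ (ball y s) = ⊤ := by
      intro y s hs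
      obtain ⟨n, hn⟩ := exists_measure_ball_le_pow_mul hdb y x hs r
      rw [htop, top_le_iff] at hn
      by_contra h
      exact ENNReal.mul_ne_top (ENNReal.pow_ne_top hC) h hn
    refine ⟨1, one_pos, fun f _ _ => ?_⟩
    rw [morreyNormQE_zero hp0]
    · exact zero_le
    · intro y s _
      simp [maximalFn_eq_zero_of_measure_ball_eq_top hall, hp0]
  push Not at hzero htop
  set B : ℝ≥0∞ := 2 * ((ENNReal.ofReal p * (2 * C₀ ^ 3) *
    ((ENNReal.ofReal (p - 1))⁻¹ * 2 ^ (p - 1))) ^ (1 / p)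
        * (C₀ ^ 2) ^ (1 / p - 1 / q.toReal) + (C₀ ^ 2) ^ (1 / q.toReal)) with hB
  have hBtop : B ≠ ⊤ := by
    have h1 : (ENNReal.ofReal (p - 1))⁻¹ ≠ ⊤ := by simpa using hp
    have h2 : (C₀ ^ 2) ^ (1 / p - 1 / q.toReal) ≠ ⊤ :=
      ENNReal.rpow_ne_top_of_nonneg (sub_nonneg.2 hexp) (by finiteness)
    finiteness
  refine ⟨B.toReal + 1, by positivity, fun f hf hN => ?_⟩
  refine (morreyNormQE_maximalFn_le hdb hzero htop hC hp hexp hf hN.ne).trans ?_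
  gcongr
  rw [← hB]
  exact (ENNReal.le_ofReal_iff_toReal_le hBtop (by positivity)).2 (by linarith)
end

section
/- Let 1 < p < q < ∞. Let φ ∈ C_c^∞(ℝ) satisfy 0 ≤ φ ≤ 1, φ ≡ 1 on (−1,1) and φ ≡ 0 outside (−2,2), and define G : ℝ → ℝ by G(x) := (1 − 1/q) x^{−1/q} φ(x) + x^{1−1/q} φ'(x) for x > 0, G(0) := 0, and G(x) := −(1 − 1/q)(−x)^{−1/q} φ(x) + (−x)^{1−1/q} φ'(x) for x < 0 (so G is a weak derivative of x ↦ |x|^{1−1/q} φ(x)). Then there exists a constant c > 0, depending only on p and q, such that for every continuous function h : ℝ → ℝ, the Morrey norm satisfies ‖G − h‖_{M_p^q(ℝ)} ≥ c. In particular, continuous functions are not dense in the Morrey space M_p^q(ℝ). -/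
open MeasureTheory Metric ENNReal Filter Real

/-- The weak derivative `G` of `x ↦ |x|^{1-1/q} φ(x)`. -/
noncomputable def weakDeriv (q : ℝ) (φ : ℝ → ℝ) (x : ℝ) : ℝ :=
  if 0 < x then (1 - 1 / q) * x ^ (-(1 / q)) * φ x + x ^ (1 - 1 / q) * deriv φ x
  else if x < 0 then
    -((1 - 1 / q) * (-x) ^ (-(1 / q)) * φ x) + (-x) ^ (1 - 1 / q) * deriv φ x
  else 0

/-- Near the origin from the right, `weakDeriv q φ` is the pure power `(1 - 1/q) x^{-1/q}`. -/
theorem weakDeriv_eq_of_mem_Ioo {q : ℝ} {φ : ℝ → ℝ} (hφ : ∀ x ∈ Set.Ioo (-1 : ℝ) 1, φ x = 1)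
    {x : ℝ} (hx : x ∈ Set.Ioo (0 : ℝ) 1) :
    weakDeriv q φ x = (1 - 1 / q) * x ^ (-(1 / q)) := by
  have hx' : x ∈ Set.Ioo (-1 : ℝ) 1 := ⟨by linarith [hx.1], hx.2⟩
  have hd : deriv φ x = 0 := by
    have he : φ =ᶠ[nhds x] fun _ => (1 : ℝ) := by
      filter_upwards [isOpen_Ioo.mem_nhds hx'] with y hy using hφ y hy
    simp [he.deriv_eq]
  simp [weakDeriv, hx.1, hφ x hx', hd]

/-- A pointwise lower bound of order `|B|^{-1/q}` on one ball `B` of `ℝ` bounds the Morrey norm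
from below. -/
theorem ofReal_le_morreyNorm {p q a r x₀ : ℝ} (hp : 0 < p) (ha : 0 ≤ a) (hr : 0 < r) {f : ℝ → ℝ}
    (hf : ∀ y ∈ ball x₀ r, a * (2 * r) ^ (-(1 / q)) ≤ |f y|) :
    ENNReal.ofReal a ≤ morreyNorm volume p q f := by
  have hs : 0 < 2 * r := by positivity
  set V := ENNReal.ofReal (2 * r) with hV
  set K := ENNReal.ofReal (a * (2 * r) ^ (-(1 / q))) with hK
  have hV0 : V ≠ 0 := by simpa [hV] using hr
  have hVt : V ≠ ⊤ := ENNReal.ofReal_ne_top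
  have hint : K ^ p * V ≤ ∫⁻ y in ball x₀ r, (‖f y‖₊ : ℝ≥0∞) ^ p := by
    rw [hV, ← Real.volume_ball x₀ r, ← setLIntegral_const]
    refine setLIntegral_mono' measurableSet_ball fun y hy => ?_
    refine ENNReal.rpow_le_rpow ?_ hp.le
    rw [← enorm_eq_nnnorm, Real.enorm_eq_ofReal_abs]
    exact ENNReal.ofReal_le_ofReal (hf y hy)
  have hval : V ^ (1 / q - 1 / p) * (K ^ p * V) ^ (1 / p) = ENNReal.ofReal a := by
    rw [ENNReal.mul_rpow_of_nonneg _ _ (by positivity), ← ENNReal.rpow_mul,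
      mul_one_div_cancel hp.ne', ENNReal.rpow_one, mul_left_comm, ← ENNReal.rpow_add _ _ hV0 hVt,
      sub_add_cancel, hK, ENNReal.ofReal_mul ha, ← ENNReal.ofReal_rpow_of_pos hs, mul_assoc,
      ← ENNReal.rpow_add _ _ hV0 hVt, neg_add_cancel, ENNReal.rpow_zero, mul_one]
  calc ENNReal.ofReal a = V ^ (1 / q - 1 / p) * (K ^ p * V) ^ (1 / p) := hval.symm
    _ ≤ volume (ball x₀ r) ^ (1 / q - 1 / p) *
        (∫⁻ y in ball x₀ r, (‖f y‖₊ : ℝ≥0∞) ^ p) ^ (1 / p) := by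
      rw [Real.volume_ball]
      gcongr
    _ ≤ morreyNorm volume p q f :=
      le_iSup_of_le x₀ (le_iSup_of_le r (le_iSup_of_le hr le_rfl))

theorem stmt9 (p q : ℝ) (hp : 1 < p) (hpq : p < q) :
    ∃ c : ℝ, 0 < c ∧
      ∀ φ : ℝ → ℝ, ContDiff ℝ (⊤ : ℕ∞) φ → HasCompactSupport φ →
        (∀ x, 0 ≤ φ x) → (∀ x, φ x ≤ 1) →
        (∀ x ∈ Set.Ioo (-1 : ℝ) 1, φ x = 1) →
        (∀ x ∉ Set.Ioo (-2 : ℝ) 2, φ x = 0) →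
        ∀ h : ℝ → ℝ, Continuous h →
          ENNReal.ofReal c ≤
            morreyNorm (volume : Measure ℝ) p q (fun x => weakDeriv q φ x - h x) := by
  have hq : 1 < q := hp.trans hpq
  have ha : 0 < (1 - 1 / q) / 2 := by
    have : 1 / q < 1 := (div_lt_one (by linarith)).2 hq
    linarith
  set a := (1 - 1 / q) / 2 with ha_def
  refine ⟨a, ha, fun φ _ _ _ _ hφ _ h hh => ?_⟩
  obtain ⟨M, hM⟩ := isCompact_Icc.exists_bound_of_continuousOn
    (hh.continuousOn (s := Set.Icc (0 : ℝ) 1))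
  have hlim : Tendsto (fun s : ℝ => s ^ (-(1 / q))) (nhdsWithin 0 (Set.Ioi 0)) atTop :=
    tendsto_rpow_neg_nhdsGT_zero (by rw [neg_lt_zero]; positivity)
  obtain ⟨s, ⟨hsM, hs1⟩, hs0⟩ := (((hlim.eventually_ge_atTop (M / a)).and
    (mem_nhdsWithin_of_mem_nhds (Iio_mem_nhds (zero_lt_one' ℝ)))).and
    self_mem_nhdsWithin).exists
  replace hs0 : 0 < s := hs0
  replace hs1 : s < 1 := hs1
  refine ofReal_le_morreyNorm (x₀ := s / 2) (r := s / 2) (by linarith) ha.le (by linarith)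
    fun y hy => ?_
  rw [Real.ball_eq_Ioo, sub_self, add_halves] at hy
  rw [mul_div_cancel₀ s two_ne_zero, weakDeriv_eq_of_mem_Ioo hφ ⟨hy.1, hy.2.trans hs1⟩]
  have hhy := hM y ⟨hy.1.le, (hy.2.trans hs1).le⟩
  rw [Real.norm_eq_abs] at hhy
  have hMs : M ≤ a * s ^ (-(1 / q)) := by rwa [div_le_iff₀' ha] at hsM
  have hys : s ^ (-(1 / q)) ≤ y ^ (-(1 / q)) :=
    Real.rpow_le_rpow_of_nonpos hy.1 hy.2.le (by rw [neg_nonpos]; positivity)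
  have hays := mul_le_mul_of_nonneg_left hys ha.le
  have h2a : 1 - 1 / q = 2 * a := by rw [ha_def]; ring
  rw [h2a]
  refine le_trans ?_ (le_abs_self _)
  linarith [le_abs_self (h y)]
end

section
/- Let 1 ≤ p < q < ∞ and α ∈ ℝ, and define f : ℝ → ℝ by f(x) := |x|^α for x ∈ (−2,2) ∖ {0} and f(x) := 0 otherwise. Then f belongs to the Morrey space M_p^q(ℝ) (with respect to Lebesgue measure) if and only if α ≥ −1/q. -/
open MeasureTheory Metric ENNReal Filter Real

lemma setLIntegral_Ioc_abs_rpow {b : ℝ} (hb : -1 < b) {r : ℝ} (hr : 0 < r) :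
    ∫⁻ y in Set.Ioc 0 r, ENNReal.ofReal (|y| ^ b) = ENNReal.ofReal (r ^ (b + 1) / (b + 1)) := by
  have h1 : ∫⁻ y in Set.Ioc 0 r, ENNReal.ofReal (|y| ^ b)
      = ∫⁻ y in Set.Ioc 0 r, ENNReal.ofReal (y ^ b) :=
    setLIntegral_congr_fun measurableSet_Ioc fun y hy => by
      simp only [abs_of_pos hy.1]
  have hi := (intervalIntegrable_iff_integrableOn_Ioc_of_le hr.le).1
    (intervalIntegral.intervalIntegrable_rpow' (a := 0) (b := r) hb)
  rw [h1, ← ofReal_integral_eq_lintegral_ofReal hi, ← intervalIntegral.integral_of_le hr.le,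
    integral_rpow (Or.inl hb), Real.zero_rpow (by linarith), sub_zero]
  exact (ae_restrict_mem measurableSet_Ioc).mono fun y hy => Real.rpow_nonneg hy.1.le _

lemma setLIntegral_Ico_abs_rpow {b : ℝ} (hb : -1 < b) {r : ℝ} (hr : 0 < r) :
    ∫⁻ y in Set.Ico (-r) 0, ENNReal.ofReal (|y| ^ b)
      = ENNReal.ofReal (r ^ (b + 1) / (b + 1)) := by
  rw [← setLIntegral_Ioc_abs_rpow hb hr]
  have h := (Measure.measurePreserving_neg (volume : Measure ℝ)).setLIntegral_comp_preimage
    (s := Set.Ioc 0 r) measurableSet_Ioc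
    (f := fun y => ENNReal.ofReal (|y| ^ b)) (by fun_prop)
  simpa using h

lemma setLIntegral_ball_abs_rpow_le {b : ℝ} (hb : -1 < b) (hb0 : b ≤ 0) (x : ℝ) {r : ℝ}
    (hr : 0 < r) :
    ∫⁻ y in ball x r, ENNReal.ofReal (|y| ^ b)
      ≤ ENNReal.ofReal ((2 / (b + 1) + 2) * r ^ (b + 1)) := by
  have hb1 : 0 < b + 1 := by linarith
  have hsub : ball x r ⊆ (Set.Ico (-r) 0 ∪ Set.Ioc 0 r) ∪ ({0} ∪ (ball x r \ Set.Icc (-r) r)) := by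
    intro y hy
    by_cases h : y ∈ Set.Icc (-r) r
    · rcases lt_trichotomy y 0 with h0 | h0 | h0
      · exact Or.inl (Or.inl ⟨h.1, h0⟩)
      · exact Or.inr (Or.inl h0)
      · exact Or.inl (Or.inr ⟨h0, h.2⟩)
    · exact Or.inr (Or.inr ⟨hy, h⟩)
  have hfar : ∫⁻ y in ball x r \ Set.Icc (-r) r, ENNReal.ofReal (|y| ^ b)
      ≤ ENNReal.ofReal (2 * r ^ (b + 1)) := by
    calc ∫⁻ y in ball x r \ Set.Icc (-r) r, ENNReal.ofReal (|y| ^ b)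
        ≤ ∫⁻ _ in ball x r \ Set.Icc (-r) r, ENNReal.ofReal (r ^ b) := by
          refine setLIntegral_mono' (measurableSet_ball.diff measurableSet_Icc) fun y hy => ?_
          refine ENNReal.ofReal_le_ofReal (Real.rpow_le_rpow_of_nonpos hr ?_ hb0)
          by_contra! h
          exact hy.2 (abs_le.1 h.le)
      _ ≤ ENNReal.ofReal (r ^ b) * ENNReal.ofReal (2 * r) := by
          rw [setLIntegral_const, ← Real.volume_ball x r]
          gcongr
          exact Set.sdiff_subset
      _ = ENNReal.ofReal (2 * r ^ (b + 1)) := by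
          rw [← ENNReal.ofReal_mul (by positivity), Real.rpow_add_one hr.ne']
          ring_nf
  calc ∫⁻ y in ball x r, ENNReal.ofReal (|y| ^ b)
      ≤ (ENNReal.ofReal (r ^ (b + 1) / (b + 1)) + ENNReal.ofReal (r ^ (b + 1) / (b + 1)))
          + (0 + ENNReal.ofReal (2 * r ^ (b + 1))) := by
        refine (lintegral_mono_set hsub).trans ((lintegral_union_le _ _ _).trans ?_)
        refine add_le_add ((lintegral_union_le _ _ _).trans ?_)
          ((lintegral_union_le _ _ _).trans ?_)
        · rw [setLIntegral_Ico_abs_rpow hb hr, setLIntegral_Ioc_abs_rpow hb hr]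
        · refine add_le_add (le_of_eq ?_) hfar
          exact setLIntegral_measure_zero _ _ (by simp)
    _ = _ := by
        rw [zero_add, ← ENNReal.ofReal_add (by positivity) (by positivity),
          ← ENNReal.ofReal_add (by positivity) (by positivity)]
        ring_nf

lemma morreyNorm_truncated_rpow_lt_top {p q α : ℝ} (hp : 1 ≤ p) (hpq : p < q)
    (h : -(1 / q) ≤ α) :
    morreyNorm (volume : Measure ℝ) p q
      ((Set.Ioo (-2 : ℝ) 2 \ {0}).indicator fun x => |x| ^ α) < ⊤ := by
  have hp0 : 0 < p := by linarith
  have hq0 : 0 < q := by linarith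
  have hpq1 : p / q < 1 := (div_lt_one hq0).2 hpq
  set b : ℝ := -(p / q) with hb
  have hb1 : -1 < b := by linarith
  have hb0 : b ≤ 0 := neg_nonpos.2 (by positivity)
  have hb2 : 0 < b + 1 := by linarith
  set C : ℝ := (2 : ℝ) ^ ((α + 1 / q) * p) with hC
  have hC0 : 0 < C := by positivity
  set K : ℝ := 2 / (b + 1) + 2 with hK
  have hK0 : 0 < K := by positivity
  have hpt (y : ℝ) : (‖(Set.Ioo (-2 : ℝ) 2 \ {0}).indicator (fun x => |x| ^ α) y‖₊ : ℝ≥0∞) ^ p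
      ≤ ENNReal.ofReal C * ENNReal.ofReal (|y| ^ b) := by
    by_cases hy : y ∈ Set.Ioo (-2 : ℝ) 2 \ {0}
    · have hy0 : 0 < |y| := abs_pos.2 hy.2
      have hy2 : |y| ≤ 2 := (abs_lt.2 hy.1).le
      rw [Set.indicator_of_mem hy, ← enorm_eq_nnnorm, Real.enorm_of_nonneg (by positivity),
        ENNReal.ofReal_rpow_of_nonneg (by positivity) hp0.le, ← ENNReal.ofReal_mul hC0.le]
      refine ENNReal.ofReal_le_ofReal ?_
      have e : α * p = (α + 1 / q) * p + b := by rw [hb]; ring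
      rw [← Real.rpow_mul hy0.le, e, Real.rpow_add hy0]
      exact mul_le_mul_of_nonneg_right
        (Real.rpow_le_rpow hy0.le hy2 (mul_nonneg (by linarith) hp0.le)) (by positivity)
    · rw [Set.indicator_of_notMem hy]
      simp [hp0]
  refine lt_of_le_of_lt (b := ENNReal.ofReal (2 ^ (1 / q - 1 / p) * (C * K) ^ (1 / p))) ?_
    ENNReal.ofReal_lt_top
  refine iSup_le fun x => iSup_le fun r => iSup_le fun hr => ?_
  have hint : ∫⁻ y in ball x r,
      (‖(Set.Ioo (-2 : ℝ) 2 \ {0}).indicator (fun x => |x| ^ α) y‖₊ : ℝ≥0∞) ^ p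
      ≤ ENNReal.ofReal (C * K * r ^ (b + 1)) := by
    refine (lintegral_mono hpt).trans ?_
    rw [lintegral_const_mul' _ _ ENNReal.ofReal_ne_top, mul_assoc, ENNReal.ofReal_mul hC0.le]
    gcongr
    exact setLIntegral_ball_abs_rpow_le hb1 hb0 x hr
  calc _ ≤ volume (ball x r) ^ (1 / q - 1 / p)
        * ENNReal.ofReal (C * K * r ^ (b + 1)) ^ (1 / p) := by gcongr
    _ = ENNReal.ofReal (2 ^ (1 / q - 1 / p) * (C * K) ^ (1 / p)) := by
      rw [Real.volume_ball, ENNReal.ofReal_rpow_of_pos (by positivity),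
        ENNReal.ofReal_rpow_of_pos (by positivity), ← ENNReal.ofReal_mul (by positivity),
        Real.mul_rpow (by norm_num) hr.le, Real.mul_rpow (by positivity) (by positivity),
        ← Real.rpow_mul hr.le]
      have e : r ^ (1 / q - 1 / p) * r ^ ((b + 1) * (1 / p)) = 1 := by
        rw [← Real.rpow_add hr]
        have : 1 / q - 1 / p + (b + 1) * (1 / p) = 0 := by rw [hb]; field_simp; ring
        rw [this, Real.rpow_zero]
      congr 1
      linear_combination (2 ^ (1 / q - 1 / p) * (C * K) ^ (1 / p)) * e

lemma le_morreyNorm_truncated_rpow {p q α : ℝ} (hp : 0 < p) (hq : 0 < q) (hα : α ≤ 0) {r : ℝ}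
    (hr : 0 < r) (hr1 : r ≤ 1) :
    ENNReal.ofReal (r ^ (1 / q + α)) ≤ morreyNorm (volume : Measure ℝ) p q
      ((Set.Ioo (-2 : ℝ) 2 \ {0}).indicator fun x => |x| ^ α) := by
  have hint : ENNReal.ofReal (r ^ (α * p) * (2 * r)) ≤ ∫⁻ y in ball 0 r,
      (‖(Set.Ioo (-2 : ℝ) 2 \ {0}).indicator (fun x => |x| ^ α) y‖₊ : ℝ≥0∞) ^ p := by
    rw [ENNReal.ofReal_mul (by positivity), ← Real.volume_ball 0 r, ← setLIntegral_const]
    refine lintegral_mono_ae ?_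
    filter_upwards [ae_restrict_mem measurableSet_ball,
      ae_restrict_of_ae (Measure.ae_ne volume (0 : ℝ))] with y hy hy0
    have hyr : |y| < r := by simpa using hy
    have hy0' : 0 < |y| := abs_pos.2 hy0
    have hmem : y ∈ Set.Ioo (-2 : ℝ) 2 \ {0} := ⟨abs_lt.1 (by linarith), hy0⟩
    rw [Set.indicator_of_mem hmem, ← enorm_eq_nnnorm, Real.enorm_of_nonneg (by positivity),
      ENNReal.ofReal_rpow_of_nonneg (by positivity) hp.le, Real.rpow_mul hr.le]
    refine ENNReal.ofReal_le_ofReal (Real.rpow_le_rpow (by positivity) ?_ hp.le)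
    exact Real.rpow_le_rpow_of_nonpos hy0' hyr.le hα
  refine le_trans ?_ (le_iSup_of_le 0 (le_iSup_of_le r (le_iSup_of_le hr le_rfl)))
  calc ENNReal.ofReal (r ^ (1 / q + α))
      ≤ ENNReal.ofReal ((2 * r) ^ (1 / q - 1 / p) * (r ^ (α * p) * (2 * r)) ^ (1 / p)) := by
        refine ENNReal.ofReal_le_ofReal ?_
        have e : (2 * r) ^ (1 / q - 1 / p) * (r ^ (α * p) * (2 * r)) ^ (1 / p)
            = 2 ^ (1 / q) * r ^ (1 / q + α) := by
          rw [Real.mul_rpow (x := r ^ (α * p)) (by positivity) (by positivity),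
            ← Real.rpow_mul hr.le, mul_left_comm, ← Real.rpow_add (by positivity), sub_add_cancel,
            mul_assoc α, mul_one_div_cancel hp.ne', mul_one, Real.mul_rpow (by norm_num) hr.le,
            Real.rpow_add hr]
          ring
        rw [e]
        exact le_mul_of_one_le_left (by positivity)
          (Real.one_le_rpow (by norm_num) (by positivity))
    _ = volume (ball (0 : ℝ) r) ^ (1 / q - 1 / p)
        * ENNReal.ofReal (r ^ (α * p) * (2 * r)) ^ (1 / p) := by
        rw [Real.volume_ball, ENNReal.ofReal_rpow_of_pos (by positivity),
          ENNReal.ofReal_rpow_of_pos (by positivity), ← ENNReal.ofReal_mul (by positivity)]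
    _ ≤ _ := by gcongr

theorem stmt10 (p q α : ℝ) (hp : 1 ≤ p) (hpq : p < q) :
    morreyNorm (volume : Measure ℝ) p q
        ((Set.Ioo (-2 : ℝ) 2 \ {0}).indicator fun x => |x| ^ α) < ⊤ ↔
      -(1 / q) ≤ α := by
  refine ⟨fun hfin => ?_, morreyNorm_truncated_rpow_lt_top hp hpq⟩
  by_contra! hα
  have hp0 : 0 < p := by linarith
  have hq0 : 0 < q := by linarith
  have hq1 : 0 < 1 / q := by positivity
  have hlim := tendsto_rpow_neg_nhdsGT_zero (y := 1 / q + α) (by linarith)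
  obtain ⟨r, hlarge, hr⟩ := ((hlim.eventually_gt_atTop
    (morreyNorm (volume : Measure ℝ) p q
      ((Set.Ioo (-2 : ℝ) 2 \ {0}).indicator fun x => |x| ^ α)).toReal).and
    (Ioc_mem_nhdsGT (zero_lt_one' ℝ))).exists
  have hle := le_morreyNorm_truncated_rpow hp0 hq0 (by linarith : α ≤ 0) hr.1 hr.2
  rw [ENNReal.ofReal_le_iff_le_toReal hfin.ne] at hle
  linarith
end

section
/- Let (X,d,μ) be a geometrically doubling metric measure space, where μ is a nonnegative Radon measure, and let 1 ≤ p ≤ q < ∞. Then for any k_1, k_2 ∈ (1,∞) there exists a constant C ≥ 1, depending only on k_1, k_2 and the geometric doubling constant N_0, such that C^{−1} ‖f‖_{M_p^{q,(k_2)}(X)} ≤ ‖f‖_{M_p^{q,(k_1)}(X)} ≤ C ‖f‖_{M_p^{q,(k_2)}(X)} for all measurable f; hence the modified Morrey space M_p^{q,(k)}(X) is independent of the choice of k ∈ (1,∞). -/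
open MeasureTheory Metric ENNReal

/-- `(X,d)` is geometrically doubling with constant `N₀`. -/
def GeomDoubling (X : Type*) [MetricSpace X] (N₀ : ℕ) : Prop :=
  ∀ (x : X) (r : ℝ) (s : Finset X), (↑s : Set X) ⊆ ball x r →
    (∀ y ∈ s, ∀ z ∈ s, y ≠ z → r / 2 < dist y z) → s.card ≤ N₀

/-- The modified Morrey norm
`‖f‖_{M_p^{q,(k)}} = sup_{B(x,r)} μ(B(x,kr))^{1/q-1/p} (∫_{B(x,r)} |f|^p dμ)^{1/p}`. -/
noncomputable def modMorreyNorm {X : Type*} [MetricSpace X] [MeasurableSpace X]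
    (μ : Measure X) (p q k : ℝ) (f : X → ℝ) : ℝ≥0∞ :=
  ⨆ (x : X) (r : ℝ) (_ : 0 < r),
    μ (ball x (k * r)) ^ (1 / q - 1 / p) *
      (∫⁻ y in ball x r, (‖f y‖₊ : ℝ≥0∞) ^ p ∂μ) ^ (1 / p)

/-- A ball of a geometrically doubling space is covered by at most `N₀` balls of radius `3/4` of the
original one. -/
lemma GeomDoubling.exists_cover {X : Type*} [MetricSpace X] {N₀ : ℕ} (h : GeomDoubling X N₀)
    (x : X) {r : ℝ} (hr : 0 < r) :
    ∃ t : Finset X, t.card ≤ N₀ ∧ ball x r ⊆ ⋃ y ∈ t, ball y (3 / 4 * r) := by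
  classical
  let P : ℕ → Prop := fun n => ∃ s : Finset X, (↑s : Set X) ⊆ ball x r ∧
    (∀ y ∈ s, ∀ z ∈ s, y ≠ z → r / 2 < dist y z) ∧ s.card = n
  have h_zero : P 0 := ⟨∅, by simp, by simp, rfl⟩
  obtain ⟨s, hsub, hsep, hcard⟩ := Nat.findGreatest_spec (Nat.zero_le N₀) h_zero
  refine ⟨s, h x r s hsub hsep, fun z hz => ?_⟩
  by_contra hzs
  simp only [Set.mem_iUnion, mem_ball, not_exists, not_lt] at hzs
  have hfar : ∀ y ∈ s, r / 2 < dist z y := fun y hy => by linarith [hzs y hy]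
  have hz_notMem : z ∉ s := fun hmem => by
    have := hfar z hmem
    rw [dist_self] at this
    linarith
  have hsub' : (↑(insert z s) : Set X) ⊆ ball x r := by
    rw [Finset.coe_insert]
    exact Set.insert_subset hz hsub
  have hsep' : ∀ y ∈ insert z s, ∀ w ∈ insert z s, y ≠ w → r / 2 < dist y w := by
    intro y hy w hw hyw
    rcases Finset.mem_insert.1 hy with rfl | hys <;>
      rcases Finset.mem_insert.1 hw with rfl | hws
    · exact absurd rfl hyw
    · exact hfar w hws
    · rw [dist_comm]
      exact hfar y hys
    · exact hsep y hys w hws hyw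
  have hle := Nat.le_findGreatest (P := P) (h x r _ hsub' hsep') ⟨_, hsub', hsep', rfl⟩
  rw [Finset.card_insert_of_notMem hz_notMem, hcard] at hle
  omega

lemma GeomDoubling.exists_cover_pow {X : Type*} [MetricSpace X] {N₀ : ℕ} (h : GeomDoubling X N₀)
    (n : ℕ) (x : X) {r : ℝ} (hr : 0 < r) :
    ∃ t : Finset X, t.card ≤ N₀ ^ n ∧ ball x r ⊆ ⋃ y ∈ t, ball y ((3 / 4) ^ n * r) := by
  classical
  induction n with
  | zero => exact ⟨{x}, by simp, by simp⟩
  | succ n ih =>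
    obtain ⟨t, ht, hcov⟩ := ih
    have hr' : 0 < (3 / 4 : ℝ) ^ n * r := by positivity
    choose u hu hucov using fun y => h.exists_cover y hr'
    refine ⟨t.biUnion u, ?_, fun z hz => ?_⟩
    · calc (t.biUnion u).card ≤ t.card * N₀ := Finset.card_biUnion_le_card_mul _ _ _ fun y _ => hu y
        _ ≤ N₀ ^ n * N₀ := Nat.mul_le_mul_right _ ht
        _ = N₀ ^ (n + 1) := (pow_succ _ _).symm
    · obtain ⟨y, hy, hzy⟩ := Set.mem_iUnion₂.1 (hcov hz)
      obtain ⟨w, hw, hzw⟩ := Set.mem_iUnion₂.1 (hucov y hzy)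
      refine Set.mem_iUnion₂.2 ⟨w, Finset.mem_biUnion.2 ⟨y, hy, hw⟩, ?_⟩
      rwa [pow_succ', mul_assoc]

lemma setLIntegral_rpow_le_sum {X : Type*} [MeasurableSpace X] (μ : Measure X) (g : X → ℝ≥0∞)
    {A : Set X} (t : Finset X) (B : X → Set X) (hA : A ⊆ ⋃ y ∈ t, B y) {s : ℝ}
    (hs : 0 < s) (hs1 : s ≤ 1) :
    (∫⁻ z in A, g z ∂μ) ^ s ≤ ∑ y ∈ t, (∫⁻ z in A ∩ B y, g z ∂μ) ^ s := by
  classical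
  induction t using Finset.induction_on generalizing A with
  | empty =>
    have : A = ∅ := by simpa [Set.subset_empty_iff] using hA
    simp [this, hs]
  | insert a t ha ih =>
    rw [Finset.sum_insert ha]
    have hrest : A \ B a ⊆ ⋃ y ∈ t, B y := by
      rintro z ⟨hzA, hza⟩
      have := hA hzA
      rw [Finset.set_biUnion_insert] at this
      exact this.resolve_left hza
    calc (∫⁻ z in A, g z ∂μ) ^ s
        ≤ (∫⁻ z in A ∩ B a, g z ∂μ + ∫⁻ z in A \ B a, g z ∂μ) ^ s := by
          gcongr
          conv_lhs => rw [← Set.inter_union_sdiff A (B a)]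
          exact lintegral_union_le _ _ _
      _ ≤ (∫⁻ z in A ∩ B a, g z ∂μ) ^ s + (∫⁻ z in A \ B a, g z ∂μ) ^ s :=
          ENNReal.rpow_add_le_add_rpow _ _ hs.le hs1
      _ ≤ _ := by
          gcongr
          refine (ih hrest).trans (Finset.sum_le_sum fun y _ => ?_)
          gcongr
          exact Set.sdiff_subset

lemma rpow_le_rpow_of_nonpos {a b : ℝ≥0∞} {s : ℝ} (hs : s ≤ 0) (hab : a ≤ b) :
    b ^ s ≤ a ^ s := by
  obtain ⟨u, rfl⟩ : ∃ u, s = -u := ⟨-s, (neg_neg s).symm⟩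
  rw [ENNReal.rpow_neg, ENNReal.rpow_neg]
  exact ENNReal.inv_le_inv.2 (ENNReal.rpow_le_rpow hab (neg_nonpos.1 hs))

/-- The modified Morrey norm with any dilation `k > 1` is controlled by the one with dilation `k'`. -/
lemma exists_modMorreyNorm_le (N₀ : ℕ) {k k' : ℝ} (hk : 1 < k) (hk' : 0 < k') :
    ∃ n : ℕ, ∀ (X : Type*) [MetricSpace X] [MeasurableSpace X] (μ : Measure X),
      GeomDoubling X N₀ → ∀ p q : ℝ, 1 ≤ p → p ≤ q → ∀ f : X → ℝ,
        modMorreyNorm μ p q k f ≤ ((N₀ ^ n : ℕ) : ℝ≥0∞) * modMorreyNorm μ p q k' f := by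
  obtain ⟨n, hn⟩ := exists_pow_lt_of_lt_one (show 0 < (k - 1) / (1 + k') by
    have := sub_pos.2 hk
    positivity) (show (3 / 4 : ℝ) < 1 by norm_num)
  rw [lt_div_iff₀ (by positivity)] at hn
  refine ⟨n, fun X _ _ μ hX p q hp hpq f => ?_⟩
  have hp0 : 0 < p := by linarith
  have hexp : 1 / q - 1 / p ≤ 0 := sub_nonpos.2 (one_div_le_one_div_of_le hp0 hpq)
  have hs : 0 < 1 / p := by positivity
  have hs1 : 1 / p ≤ 1 := (div_le_one hp0).2 hp
  refine iSup_le fun x => iSup_le fun r => iSup_le fun hr => ?_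
  obtain ⟨t, ht, hcov⟩ := hX.exists_cover_pow n x hr
  set ρ : ℝ := (3 / 4) ^ n * r with hρ
  have hρ0 : 0 < ρ := by positivity
  have hsmall : ρ * (1 + k') ≤ (k - 1) * r := by
    rw [hρ]
    nlinarith
  have hterm : ∀ y ∈ t, μ (ball x (k * r)) ^ (1 / q - 1 / p) *
      (∫⁻ z in ball x r ∩ ball y ρ, (‖f z‖₊ : ℝ≥0∞) ^ p ∂μ) ^ (1 / p) ≤
        modMorreyNorm μ p q k' f := by
    intro y _
    rcases (ball x r ∩ ball y ρ).eq_empty_or_nonempty with hempty | ⟨z, hzx, hzy⟩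
    · simp [hempty, hp0]
    have hball : ball y (k' * ρ) ⊆ ball x (k * r) := by
      refine ball_subset_ball' ?_
      rw [mem_ball] at hzx hzy
      have := dist_triangle_left y x z
      nlinarith
    refine le_trans ?_ (le_iSup_of_le y (le_iSup_of_le ρ (le_iSup_of_le hρ0 le_rfl)))
    gcongr ?_ * (?_) ^ (1 / p)
    · exact rpow_le_rpow_of_nonpos hexp (measure_mono hball)
    · exact lintegral_mono_set Set.inter_subset_right
  calc _ ≤ μ (ball x (k * r)) ^ (1 / q - 1 / p) *
        ∑ y ∈ t, (∫⁻ z in ball x r ∩ ball y ρ, (‖f z‖₊ : ℝ≥0∞) ^ p ∂μ) ^ (1 / p) := by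
        gcongr
        exact setLIntegral_rpow_le_sum μ _ t _ hcov hs hs1
    _ ≤ t.card * modMorreyNorm μ p q k' f := by
        rw [Finset.mul_sum, ← nsmul_eq_mul]
        exact Finset.sum_le_card_nsmul _ _ _ hterm
    _ ≤ _ := by gcongr

theorem stmt12 (N₀ : ℕ) (k₁ k₂ : ℝ) (hk₁ : 1 < k₁) (hk₂ : 1 < k₂) :
    ∃ C : ℝ, 1 ≤ C ∧
      ∀ (X : Type) [MetricSpace X] [MeasurableSpace X] [BorelSpace X]
        (μ : Measure X) [μ.Regular], GeomDoubling X N₀ →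
        ∀ p q : ℝ, 1 ≤ p → p ≤ q →
          ∀ f : X → ℝ, Measurable f →
            modMorreyNorm μ p q k₂ f ≤ ENNReal.ofReal C * modMorreyNorm μ p q k₁ f ∧
            modMorreyNorm μ p q k₁ f ≤ ENNReal.ofReal C * modMorreyNorm μ p q k₂ f := by
  obtain ⟨m, hm⟩ := exists_modMorreyNorm_le.{0} N₀ hk₂ (zero_lt_one.trans hk₁)
  obtain ⟨n, hn⟩ := exists_modMorreyNorm_le.{0} N₀ hk₁ (zero_lt_one.trans hk₂)
  refine ⟨((N₀ ^ m + N₀ ^ n + 1 : ℕ) : ℝ), by exact_mod_cast Nat.le_add_left _ _, ?_⟩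
  intro X _ _ _ μ _ hX p q hp hpq f _
  rw [ENNReal.ofReal_natCast]
  constructor
  · refine (hm X μ hX p q hp hpq f).trans ?_
    gcongr
    omega
  · refine (hn X μ hX p q hp hpq f).trans ?_
    gcongr
    omega
end

section
/- Let β ∈ (1,∞) and let (X,d,μ) be a geometrically doubling metric measure space, where μ is a nonnegative Radon measure. Then there exists a constant C > 0, depending only on β and the geometric doubling constant N_0, such that for all λ ∈ (0,∞) and all f ∈ L^1(X,μ): μ({x ∈ X : M_0^{(β)} f(x) > λ}) ≤ (C/λ) ‖f‖_{L^1(X,μ)}. -/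
open MeasureTheory Metric ENNReal

/-- The modified maximal operator `M_0^{(β)} f(x) = sup_{r>0} μ(B(x,βr))⁻¹ ∫_{B(x,r)} |f| dμ`. -/
noncomputable def modMax {X : Type*} [MetricSpace X] [MeasurableSpace X]
    (μ : Measure X) (β : ℝ) (f : X → ℝ) (x : X) : ℝ≥0∞ :=
  ⨆ (r : ℝ) (_ : 0 < r),
    (μ (ball x (β * r)))⁻¹ * ∫⁻ y in ball x r, (‖f y‖₊ : ℝ≥0∞) ∂μ

/-- In a geometrically doubling space, the size of a `δ`-separated subset of a ball of radius `r`
is bounded in terms of `δ / r`. -/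
theorem GeomDoubling.card_le_pow {X : Type*} [MetricSpace X] {N₀ : ℕ} (h : GeomDoubling X N₀)
    (k : ℕ) : ∀ (x : X) (r δ : ℝ) (s : Finset X), 0 < r → r * (3 / 4) ^ k ≤ δ →
      (↑s : Set X) ⊆ ball x r → (∀ y ∈ s, ∀ z ∈ s, y ≠ z → δ < dist y z) →
      s.card ≤ N₀ ^ (k + 1) := by
  classical
  induction k with
  | zero =>
    intro x r δ s hr hδ hs hsep
    rw [pow_zero, mul_one] at hδ
    simpa using h x r s hs fun y hy z hz hyz => by linarith [hsep y hy z hz hyz]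
  | succ k ih =>
    intro x r δ s hr hδ hs hsep
    let P : Finset X → Prop := fun t => ∀ y ∈ t, ∀ z ∈ t, y ≠ z → r / 2 < dist y z
    obtain ⟨t, ht, hmax⟩ := (s.powerset.filter P).exists_max_image Finset.card
      ⟨∅, by simp [P]⟩
    rw [Finset.mem_filter, Finset.mem_powerset] at ht
    obtain ⟨hts, htP⟩ := ht
    have hcover : ∀ y ∈ s, ∃ p ∈ t, dist y p ≤ r / 2 := by
      intro y hy
      by_contra! hfar
      have hyt : y ∉ t := fun hyt => by
        have := hfar y hyt
        rw [dist_self] at this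
        linarith
      have hins : insert y t ∈ s.powerset.filter P := by
        rw [Finset.mem_filter, Finset.mem_powerset]
        refine ⟨Finset.insert_subset hy hts, ?_⟩
        intro a ha b hb hab
        rw [Finset.mem_insert] at ha hb
        rcases ha with rfl | ha <;> rcases hb with rfl | hb
        · exact absurd rfl hab
        · exact hfar b hb
        · rw [dist_comm]
          exact hfar a ha
        · exact htP a ha b hb hab
      have := hmax _ hins
      rw [Finset.card_insert_of_notMem hyt] at this
      omega
    have hsub : s ⊆ t.biUnion fun p => s.filter fun y => dist y p ≤ r / 2 := by
      intro y hy
      obtain ⟨p, hp, hyp⟩ := hcover y hy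
      exact Finset.mem_biUnion.2 ⟨p, hp, Finset.mem_filter.2 ⟨hy, hyp⟩⟩
    have hpiece : ∀ p ∈ t, (s.filter fun y => dist y p ≤ r / 2).card ≤ N₀ ^ (k + 1) := by
      intro p _
      refine ih p (r * (3 / 4)) δ _ (by positivity) (by rw [pow_succ] at hδ; linarith) ?_ ?_
      · intro y hy
        have := (Finset.mem_filter.1 (Finset.mem_coe.1 hy)).2
        rw [mem_ball]
        linarith
      · intro y hy z hz
        exact hsep y (Finset.mem_filter.1 hy).1 z (Finset.mem_filter.1 hz).1
    calc s.card ≤ _ := Finset.card_le_card hsub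
      _ ≤ t.card * N₀ ^ (k + 1) := Finset.card_biUnion_le_card_mul _ _ _ hpiece
      _ ≤ N₀ * N₀ ^ (k + 1) :=
        Nat.mul_le_mul_right _ (h x r t (fun y hy => hs (hts hy)) htP)
      _ = N₀ ^ (k + 1 + 1) := by ring

/-- If the center of each ball lies outside the `γ`-dilates of the others, with `γ > 1`, then the
balls have bounded overlap. -/
theorem GeomDoubling.card_le_of_mem_ball {X : Type*} [MetricSpace X] {N₀ : ℕ}
    (h : GeomDoubling X N₀) {γ : ℝ} (hγ : 1 < γ) {k : ℕ} (hk : (3 / 4 : ℝ) ^ k < γ - 1)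
    (ρ : X → ℝ) (F : Finset X) (hρ : ∀ a ∈ F, 0 < ρ a)
    (hsep : ∀ a ∈ F, ∀ b ∈ F, a ≠ b → γ * max (ρ a) (ρ b) ≤ dist a b)
    (z : X) (hz : ∀ a ∈ F, z ∈ ball a (ρ a)) : F.card ≤ N₀ ^ (k + 1) := by
  rcases F.eq_empty_or_nonempty with rfl | hF
  · simp
  obtain ⟨a, ha, hmax⟩ := F.exists_max_image ρ hF
  have hra := hρ a ha
  have hk1 : (3 / 4 : ℝ) ^ k ≤ 1 := pow_le_one₀ (by norm_num) (by norm_num)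
  have hcomp : ∀ b ∈ F, ρ a * (3 / 4) ^ k ≤ ρ b := by
    intro b hb
    by_cases hab : a = b
    · subst hab
      nlinarith
    · have h₁ := hsep a ha b hb hab
      have h₂ := mem_ball.1 (hz a ha)
      have h₃ := mem_ball.1 (hz b hb)
      have h₄ := dist_triangle_left a b z
      rw [max_eq_left (hmax b hb)] at h₁
      nlinarith
  refine h.card_le_pow k z (ρ a) _ F hra le_rfl ?_ ?_
  · intro b hb
    rw [mem_ball']
    exact (mem_ball.1 (hz b hb)).trans_le (hmax b hb)
  · intro b hb c hc hbc
    have h₁ := hsep b hb c hc hbc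
    have h₂ := hcomp b hb
    have h₃ := hρ b hb
    have h₄ := le_max_left (ρ b) (ρ c)
    nlinarith

/-- Any family of centered balls with bounded positive radii has a subfamily whose `γ ^ 2`-dilates
cover the centers, and in which each center lies outside the `γ`-dilates of the other balls. -/
theorem exists_separated_subfamily {X : Type*} [MetricSpace X] {γ : ℝ} (hγ : 1 < γ)
    (t : Set X) (ρ : X → ℝ) (hρ : ∀ a ∈ t, 0 < ρ a) (R : ℝ) (hR : ∀ a ∈ t, ρ a ≤ R) :
    ∃ u ⊆ t, (∀ a ∈ u, ∀ b ∈ u, a ≠ b → γ * max (ρ a) (ρ b) ≤ dist a b) ∧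
      t ⊆ ⋃ b ∈ u, ball b (γ ^ 2 * ρ b) := by
  let B : X → Set (X × X) := fun a =>
    {p | (p.1 = a ∨ p.2 = a) ∧ dist p.1 p.2 < γ * max (ρ p.1) (ρ p.2)}
  obtain ⟨u, hut, hdisj, hcov⟩ := Vitali.exists_disjoint_subfamily_covering_enlargement B t ρ γ hγ
    (fun a ha => (hρ a ha).le) R hR
    (fun a ha => ⟨(a, a), Or.inl rfl, by
      have := hρ a ha
      simp only [dist_self, max_self]
      positivity⟩)
  refine ⟨u, hut, ?_, ?_⟩
  · intro a ha b hb hab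
    by_contra! hlt
    have hmem : (a, b) ∈ B a ∩ B b := ⟨⟨Or.inl rfl, hlt⟩, ⟨Or.inr rfl, hlt⟩⟩
    exact Set.disjoint_left.1 (hdisj ha hb hab) hmem.1 hmem.2
  · intro a ha
    obtain ⟨b, hb, ⟨⟨p, q⟩, ⟨hpa, hlt⟩, ⟨hpb, -⟩⟩, hle⟩ := hcov a ha
    have hb0 := hρ b (hut hb)
    have hmax : max (ρ a) (ρ b) ≤ γ * ρ b := max_le hle (by nlinarith)
    have key : dist a b < γ * max (ρ a) (ρ b) := by
      by_cases hab : a = b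
      · subst hab
        rw [dist_self, max_self]
        positivity
      · dsimp only at hpa hpb hlt
        rcases hpa with rfl | rfl <;> rcases hpb with rfl | rfl
        · exact absurd rfl hab
        · exact hlt
        · rwa [dist_comm, max_comm]
        · exact absurd rfl hab
    refine Set.mem_iUnion₂.2 ⟨b, hb, ?_⟩
    rw [mem_ball]
    nlinarith

/-- The integrals over sets with overlap at most `N` add up to at most `N` times the integral. -/
theorem sum_setLIntegral_le_of_card_le {X ι : Type*} [MeasurableSpace X] {μ : Measure X}
    {g : X → ℝ≥0∞} (hg : AEMeasurable g μ) (F : Finset ι) (S : ι → Set X)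
    (hS : ∀ i ∈ F, MeasurableSet (S i)) (N : ℕ)
    (hN : ∀ z, ∀ G ⊆ F, (∀ i ∈ G, z ∈ S i) → G.card ≤ N) :
    ∑ i ∈ F, ∫⁻ y in S i, g y ∂μ ≤ N * ∫⁻ y, g y ∂μ := by
  classical
  calc ∑ i ∈ F, ∫⁻ y in S i, g y ∂μ = ∑ i ∈ F, ∫⁻ y, (S i).indicator g y ∂μ :=
        Finset.sum_congr rfl fun i hi => (lintegral_indicator (hS i hi) g).symm
    _ = ∫⁻ y, ∑ i ∈ F, (S i).indicator g y ∂μ :=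
        (lintegral_finsetSum' F fun i hi => hg.indicator (hS i hi)).symm
    _ ≤ ∫⁻ y, N * g y ∂μ := by
        refine lintegral_mono fun y => ?_
        simp only [Set.indicator_apply]
        rw [← Finset.sum_filter, Finset.sum_const, nsmul_eq_mul]
        gcongr
        exact hN y _ (Finset.filter_subset _ _) fun i hi => (Finset.mem_filter.1 hi).2
    _ = N * ∫⁻ y, g y ∂μ := lintegral_const_mul' _ _ (natCast_ne_top N)

/-- Weak-type bound for the maximal operator truncated to radii at most `R`. -/
theorem GeomDoubling.mul_measure_truncated_le {X : Type*} [MetricSpace X] [MeasurableSpace X]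
    [BorelSpace X] {N₀ : ℕ} (h : GeomDoubling X N₀) {γ : ℝ} (hγ : 1 < γ) {k : ℕ}
    (hk : (3 / 4 : ℝ) ^ k < γ - 1) {μ : Measure X} {g : X → ℝ≥0∞} (hg : AEMeasurable g μ)
    (hfin : ∫⁻ y, g y ∂μ ≠ ∞) (c : ℝ≥0∞) (R : ℝ) :
    c * μ {x | ∃ r, 0 < r ∧ r ≤ R ∧ c * μ (ball x (γ ^ 2 * r)) < ∫⁻ y in ball x r, g y ∂μ} ≤
      (N₀ ^ (k + 1) : ℕ) * ∫⁻ y, g y ∂μ := by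
  set t := {x | ∃ r, 0 < r ∧ r ≤ R ∧ c * μ (ball x (γ ^ 2 * r)) < ∫⁻ y in ball x r, g y ∂μ}
  have hex : ∀ x, ∃ r, x ∈ t →
      0 < r ∧ r ≤ R ∧ c * μ (ball x (γ ^ 2 * r)) < ∫⁻ y in ball x r, g y ∂μ := by
    intro x
    by_cases hx : x ∈ t
    · obtain ⟨r, hr⟩ := hx
      exact ⟨r, fun _ => hr⟩
    · exact ⟨0, fun hx' => absurd hx' hx⟩
  choose ρ hρ using hex
  obtain ⟨u, hut, hsep, hcov⟩ := exists_separated_subfamily hγ t ρ (fun a ha => (hρ a ha).1) R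
    fun a ha => (hρ a ha).2.1
  have hsum : ∑' a : u, ∫⁻ y in ball (a : X) (ρ a), g y ∂μ ≤
      (N₀ ^ (k + 1) : ℕ) * ∫⁻ y, g y ∂μ := by
    rw [ENNReal.tsum_eq_iSup_sum]
    refine iSup_le fun F => ?_
    refine sum_setLIntegral_le_of_card_le hg F (fun a : u => ball (a : X) (ρ a))
      (fun _ _ => measurableSet_ball) _ fun z G _ hz => ?_
    rw [← Finset.card_map (Function.Embedding.subtype (· ∈ u))]
    refine h.card_le_of_mem_ball hγ hk ρ _ ?_ ?_ z ?_
    · simp only [Finset.mem_map, Function.Embedding.subtype_apply]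
      rintro _ ⟨a, _, rfl⟩
      exact (hρ a (hut a.2)).1
    · simp only [Finset.mem_map, Function.Embedding.subtype_apply]
      rintro _ ⟨a, _, rfl⟩ _ ⟨b, _, rfl⟩
      exact hsep a a.2 b b.2
    · simp only [Finset.mem_map, Function.Embedding.subtype_apply]
      rintro _ ⟨a, ha, rfl⟩
      exact hz a ha
  have hcount : u.Countable := by
    have hsupp := Summable.countable_support_ennreal
      (ne_top_of_le_ne_top (mul_ne_top (natCast_ne_top _) hfin) hsum)
    have huniv : Function.support (fun a : u => ∫⁻ y in ball (a : X) (ρ a), g y ∂μ) = Set.univ :=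
      Set.eq_univ_of_forall fun a => (hρ a (hut a.2)).2.2.ne_bot
    rw [huniv] at hsupp
    exact Set.countable_coe_iff.1 (Set.countable_univ_iff.1 hsupp)
  calc c * μ t ≤ c * ∑' a : u, μ (ball (a : X) (γ ^ 2 * ρ a)) := by
        gcongr
        exact (measure_mono hcov).trans (measure_biUnion_le μ hcount _)
    _ = ∑' a : u, c * μ (ball (a : X) (γ ^ 2 * ρ a)) := ENNReal.tsum_mul_left.symm
    _ ≤ ∑' a : u, ∫⁻ y in ball (a : X) (ρ a), g y ∂μ :=
        ENNReal.tsum_le_tsum fun a => (hρ a (hut a.2)).2.2.le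
    _ ≤ _ := hsum

theorem stmt14 (N₀ : ℕ) (β : ℝ) (hβ : 1 < β) :
    ∃ C : ℝ, 0 < C ∧
      ∀ (X : Type) [MetricSpace X] [MeasurableSpace X] [BorelSpace X]
        (μ : Measure X) [μ.Regular], GeomDoubling X N₀ →
        ∀ f : X → ℝ, Integrable f μ →
          ∀ lam : ℝ, 0 < lam →
            μ {x : X | ENNReal.ofReal lam < modMax μ β f x} ≤
              ENNReal.ofReal (C / lam) * ∫⁻ y, (‖f y‖₊ : ℝ≥0∞) ∂μ := by
  obtain ⟨γ, hγ, rfl⟩ : ∃ γ : ℝ, 1 < γ ∧ γ ^ 2 = β :=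
    ⟨√β, Real.lt_sqrt_of_sq_lt (by simpa using hβ), Real.sq_sqrt (by linarith)⟩
  obtain ⟨k, hk⟩ := exists_pow_lt_of_lt_one (sub_pos.2 hγ) (by norm_num : (3 / 4 : ℝ) < 1)
  refine ⟨(N₀ ^ (k + 1) : ℕ) + 1, by positivity, ?_⟩
  intro X _ _ _ μ _ h f hf lam hlam
  have hg : AEMeasurable (fun y => (‖f y‖₊ : ℝ≥0∞)) μ := hf.aestronglyMeasurable.enorm
  have hfin : ∫⁻ y, (‖f y‖₊ : ℝ≥0∞) ∂μ ≠ ∞ := hf.hasFiniteIntegral.ne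
  set c := ENNReal.ofReal lam with hc
  have hc0 : c ≠ 0 := (ENNReal.ofReal_pos.2 hlam).ne'
  let E : ℕ → Set X := fun n => {x | ∃ r, 0 < r ∧ r ≤ (n : ℝ) ∧
    c * μ (ball x (γ ^ 2 * r)) < ∫⁻ y in ball x r, (‖f y‖₊ : ℝ≥0∞) ∂μ}
  have hmono : Monotone E := by
    rintro m n hmn x ⟨r, hr, hrm, hlt⟩
    exact ⟨r, hr, hrm.trans (by exact_mod_cast hmn), hlt⟩
  have hsub : {x : X | c < modMax μ (γ ^ 2) f x} ⊆ ⋃ n, E n := by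
    intro x hx
    simp only [Set.mem_ofPred_eq, modMax, lt_iSup_iff] at hx
    obtain ⟨r, hr, hlt⟩ := hx
    obtain ⟨n, hn⟩ := exists_nat_ge r
    refine Set.mem_iUnion.2 ⟨n, r, hr, hn, ?_⟩
    rw [mul_comm, ← div_eq_mul_inv] at hlt
    exact ENNReal.mul_lt_of_lt_div hlt
  have hbound : c * μ {x : X | c < modMax μ (γ ^ 2) f x} ≤
      (N₀ ^ (k + 1) : ℕ) * ∫⁻ y, (‖f y‖₊ : ℝ≥0∞) ∂μ := by
    refine (mul_le_mul_right (measure_mono hsub) c).trans ?_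
    rw [hmono.measure_iUnion, ENNReal.mul_iSup]
    exact iSup_le fun n => h.mul_measure_truncated_le hγ hk hg hfin c n
  rw [ENNReal.ofReal_div_of_pos hlam, ← hc, div_eq_mul_inv, mul_right_comm, ← div_eq_mul_inv,
    ENNReal.le_div_iff_mul_le (Or.inl hc0) (Or.inl ofReal_ne_top), mul_comm]
  refine hbound.trans ?_
  gcongr
  rw [← ENNReal.ofReal_natCast]
  exact ENNReal.ofReal_le_ofReal (by linarith)
end

section
/- Let (X,d,μ) be a geometrically doubling metric measure space, where μ is a nonnegative Radon measure, let 1 < p ≤ q < ∞, β ∈ (1,∞), α ∈ (0,1/q) and k ∈ (1,∞). Then there exists a constant C > 0 such that for all f ∈ M_p^{q,(k)}(X): ‖M_α^{(β)} f‖_{M_{p̃}^{q̃,(k)}(X)} ≤ C ‖f‖_{M_p^{q,(k)}(X)}, where p̃ := p/(1 − αq) and q̃ := q/(1 − αq). -/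
open MeasureTheory Metric ENNReal

/-- The modified Morrey norm for `ℝ≥0∞`-valued functions. -/
noncomputable def modMorreyNormE {X : Type*} [MetricSpace X] [MeasurableSpace X]
    (μ : Measure X) (p q k : ℝ) (f : X → ℝ≥0∞) : ℝ≥0∞ :=
  ⨆ (x : X) (r : ℝ) (_ : 0 < r),
    μ (ball x (k * r)) ^ (1 / q - 1 / p) *
      (∫⁻ y in ball x r, (f y) ^ p ∂μ) ^ (1 / p)

/-- The modified fractional maximal operator
`M_α^{(β)} f(x) = sup_{r>0} μ(B(x,βr))^{α-1} ∫_{B(x,r)} |f| dμ`. -/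
noncomputable def modFracMax {X : Type*} [MetricSpace X] [MeasurableSpace X]
    (μ : Measure X) (α β : ℝ) (f : X → ℝ) (x : X) : ℝ≥0∞ :=
  ⨆ (r : ℝ) (_ : 0 < r),
    μ (ball x (β * r)) ^ (α - 1) * ∫⁻ y in ball x r, (‖f y‖₊ : ℝ≥0∞) ∂μ

section Covering

variable {X : Type*} [MetricSpace X]

/-- A maximal `δ`-separated subset of a set with bounded packing numbers is a `δ`-net. -/
theorem exists_finset_cover_of_packing {A : Set X} {δ : ℝ} (hδ : 0 < δ) {N : ℕ}
    (h : ∀ s : Finset X, (↑s : Set X) ⊆ A →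
      (∀ y ∈ s, ∀ z ∈ s, y ≠ z → δ ≤ dist y z) → s.card ≤ N) :
    ∃ s : Finset X, (↑s : Set X) ⊆ A ∧ s.card ≤ N ∧ A ⊆ ⋃ y ∈ s, ball y δ := by
  classical
  let P : ℕ → Prop := fun n => ∃ s : Finset X, (↑s : Set X) ⊆ A ∧
    (∀ y ∈ s, ∀ z ∈ s, y ≠ z → δ ≤ dist y z) ∧ s.card = n
  have hP0 : P 0 := ⟨∅, by simp, by simp, by simp⟩
  obtain ⟨s, hsA, hsep, hcard⟩ : P (Nat.findGreatest P N) :=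
    Nat.findGreatest_spec (Nat.zero_le N) hP0
  refine ⟨s, hsA, h s hsA hsep, fun x hx => ?_⟩
  by_contra hcov
  simp only [Set.mem_iUnion, mem_ball, not_exists, not_lt] at hcov
  have hxs : x ∉ s := fun hxs => by
    have := hcov x hxs
    rw [dist_self] at this
    linarith
  have hA' : (↑(insert x s) : Set X) ⊆ A := by
    rw [Finset.coe_insert]
    exact Set.insert_subset hx hsA
  have hsep' : ∀ y ∈ insert x s, ∀ z ∈ insert x s, y ≠ z → δ ≤ dist y z := by
    intro y hy z hz hyz
    rcases Finset.mem_insert.1 hy with rfl | hy' <;> rcases Finset.mem_insert.1 hz with rfl | hz'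
    · exact absurd rfl hyz
    · exact hcov z hz'
    · rw [dist_comm]
      exact hcov y hy'
    · exact hsep y hy' z hz' hyz
  have hle : (insert x s).card ≤ Nat.findGreatest P N :=
    Nat.le_findGreatest (h _ hA' hsep') ⟨_, hA', hsep', rfl⟩
  rw [Finset.card_insert_of_notMem hxs] at hle
  omega

/-- In a geometrically doubling space, `ε r`-separated subsets of balls of radius `r` have
uniformly bounded cardinality. -/
theorem GeomDoubling.exists_packing_bound {N₀ : ℕ} (hX : GeomDoubling X N₀) {ε : ℝ}
    (hε : 0 < ε) :
    ∃ N : ℕ, ∀ (x : X) (r : ℝ), 0 < r → ∀ s : Finset X, (↑s : Set X) ⊆ ball x r →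
      (∀ y ∈ s, ∀ z ∈ s, y ≠ z → ε * r ≤ dist y z) → s.card ≤ N := by
  classical
  have key : ∀ n : ℕ, ∃ N : ℕ, ∀ (x : X) (r : ℝ), 0 < r → ∀ s : Finset X,
      (↑s : Set X) ⊆ ball x r →
      (∀ y ∈ s, ∀ z ∈ s, y ≠ z → (2 / 3 : ℝ) ^ n * r ≤ dist y z) → s.card ≤ N := by
    intro n
    induction n with
    | zero =>
      refine ⟨N₀, fun x r hr s hs hsep => hX x r s hs fun y hy z hz hyz => ?_⟩
      have := hsep y hy z hz hyz
      simp only [pow_zero, one_mul] at this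
      linarith
    | succ n ih =>
      obtain ⟨N, hN⟩ := ih
      refine ⟨N₀ * N, fun x r hr s hs hsep => ?_⟩
      obtain ⟨t, -, htcard, htcov⟩ := exists_finset_cover_of_packing (A := ball x r)
        (δ := 2 / 3 * r) (by positivity) (N := N₀) fun u hu husep =>
          hX x r u hu fun y hy z hz hyz => by
            have := husep y hy z hz hyz
            linarith
      have hsub : s ⊆ t.biUnion fun y => s.filter (· ∈ ball y (2 / 3 * r)) := by
        intro z hz
        obtain ⟨y, hy, hzy⟩ := Set.mem_iUnion₂.1 (htcov (hs hz))
        exact Finset.mem_biUnion.2 ⟨y, hy, Finset.mem_filter.2 ⟨hz, hzy⟩⟩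
      refine (Finset.card_le_card hsub).trans ((Finset.card_biUnion_le_card_mul _ _ N ?_).trans
        (Nat.mul_le_mul_right N htcard))
      intro y _
      refine hN y (2 / 3 * r) (by positivity) _ (fun z hz => ?_) fun a ha b hb hab => ?_
      · exact (Finset.mem_filter.1 hz).2
      · have := hsep a (Finset.mem_filter.1 ha).1 b (Finset.mem_filter.1 hb).1 hab
        rw [pow_succ] at this
        linarith
  obtain ⟨n, hn⟩ := exists_pow_lt_of_lt_one hε (by norm_num : (2 / 3 : ℝ) < 1)
  obtain ⟨N, hN⟩ := key n
  refine ⟨N, fun x r hr s hs hsep => hN x r hr s hs fun y hy z hz hyz => ?_⟩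
  exact (mul_le_mul_of_nonneg_right hn.le hr.le).trans (hsep y hy z hz hyz)

/-- In a geometrically doubling space, balls of radius `r` are covered by boundedly many balls
of radius `ε r` centred in them. -/
theorem GeomDoubling.exists_cover_s17 {N₀ : ℕ} (hX : GeomDoubling X N₀) {ε : ℝ} (hε : 0 < ε) :
    ∃ N : ℕ, ∀ (x : X) (r : ℝ), 0 < r → ∃ s : Finset X, (↑s : Set X) ⊆ ball x r ∧ s.card ≤ N ∧
      ball x r ⊆ ⋃ y ∈ s, ball y (ε * r) := by
  obtain ⟨N, hN⟩ := hX.exists_packing_bound hε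
  exact ⟨N, fun x r hr => exists_finset_cover_of_packing (by positivity) (hN x r hr)⟩

theorem GeomDoubling.secondCountableTopology {N₀ : ℕ} (hX : GeomDoubling X N₀) :
    SecondCountableTopology X := by
  rcases isEmpty_or_nonempty X with hE | ⟨⟨x₀⟩⟩
  · infer_instance
  refine Metric.secondCountable_of_almost_dense_set fun ε hε => ?_
  have h : ∀ n : ℕ, ∃ s : Finset X, ball x₀ (n + 1) ⊆ ⋃ y ∈ s, ball y ε := by
    intro n
    have hn : (0 : ℝ) < n + 1 := by positivity
    obtain ⟨N, hN⟩ := hX.exists_cover_s17 (ε := ε / (n + 1)) (by positivity)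
    obtain ⟨s, -, -, hs⟩ := hN x₀ (n + 1) hn
    rw [div_mul_cancel₀ _ hn.ne'] at hs
    exact ⟨s, hs⟩
  choose s hs using h
  refine ⟨⋃ n, (s n : Set X), Set.countable_iUnion fun n => (s n).countable_toSet, fun x => ?_⟩
  obtain ⟨n, hn⟩ := exists_nat_gt (dist x x₀)
  obtain ⟨y, hy, hxy⟩ := Set.mem_iUnion₂.1 (hs n (mem_ball.2 (hn.trans (lt_add_one _))))
  exact ⟨y, Set.mem_iUnion.2 ⟨n, hy⟩, (mem_ball.1 hxy).le⟩

/-- Greedy selection by decreasing radius from a finite family of balls. -/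
theorem exists_separated_subfamily_s17 {b : ℝ} (hb : 0 < b) (T : Finset (X × ℝ))
    (hT : ∀ i ∈ T, 0 < i.2) :
    ∃ S ⊆ T, (∀ i ∈ S, ∀ j ∈ S, i ≠ j → b * max i.2 j.2 ≤ dist i.1 j.1) ∧
      ∀ i ∈ T, ∃ j ∈ S, i.2 ≤ j.2 ∧ dist i.1 j.1 < b * j.2 := by
  classical
  induction T using Finset.strongInduction with
  | H T ih =>
    rcases T.eq_empty_or_nonempty with rfl | hne
    · exact ⟨∅, by simp, by simp, by simp⟩
    obtain ⟨m, hm, hmax⟩ := T.exists_max_image Prod.snd hne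
    have hm0 := hT m hm
    have hss : T.filter (fun i => b * m.2 ≤ dist i.1 m.1) ⊂ T := by
      refine Finset.filter_ssubset.2 ⟨m, hm, ?_⟩
      rw [dist_self, not_le]
      positivity
    obtain ⟨S, hST, hsep, hcov⟩ := ih _ hss fun i hi => hT i (Finset.mem_filter.1 hi).1
    have hfar : ∀ i ∈ S, b * max i.2 m.2 ≤ dist i.1 m.1 := fun i hi => by
      have hi' := Finset.mem_filter.1 (hST hi)
      rw [max_eq_right (hmax i hi'.1)]
      exact hi'.2
    refine ⟨insert m S, Finset.insert_subset hm (hST.trans hss.1), ?_, ?_⟩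
    · intro i hi j hj hij
      rcases Finset.mem_insert.1 hi with rfl | hi' <;> rcases Finset.mem_insert.1 hj with rfl | hj'
      · exact absurd rfl hij
      · rw [max_comm, dist_comm]
        exact hfar j hj'
      · exact hfar i hi'
      · exact hsep i hi' j hj' hij
    · intro i hi
      by_cases him : b * m.2 ≤ dist i.1 m.1
      · obtain ⟨j, hj, h⟩ := hcov i (Finset.mem_filter.2 ⟨hi, him⟩)
        exact ⟨j, Finset.mem_insert_of_mem hj, h⟩
      · exact ⟨m, Finset.mem_insert_self _ _, hmax i hi, not_le.1 him⟩

/-- Families of balls whose centres are separated relative to the larger radius, with separation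
constant `b > 1`, have bounded overlap. -/
theorem GeomDoubling.exists_overlap_bound {N₀ : ℕ} (hX : GeomDoubling X N₀) {b : ℝ}
    (hb : 1 < b) :
    ∃ N : ℕ, ∀ S : Finset (X × ℝ),
      (∀ i ∈ S, ∀ j ∈ S, i ≠ j → b * max i.2 j.2 ≤ dist i.1 j.1) →
      ∀ z : X, (∀ i ∈ S, z ∈ ball i.1 i.2) → S.card ≤ N := by
  classical
  obtain ⟨N, hN⟩ := hX.exists_packing_bound (sub_pos.2 hb)
  refine ⟨N, fun S hsep z hz => ?_⟩
  rcases S.eq_empty_or_nonempty with rfl | hne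
  · simp
  have hpos : ∀ i ∈ S, 0 < i.2 := fun i hi => pos_of_mem_ball (hz i hi)
  obtain ⟨m, hm, hmax⟩ := S.exists_max_image Prod.snd hne
  have hR := hpos m hm
  have hsep' : ∀ i ∈ S, ∀ j ∈ S, i ≠ j → (b - 1) * m.2 ≤ dist i.1 j.1 := by
    have hr : ∀ i ∈ S, (b - 1) * m.2 ≤ b * i.2 := by
      intro i hi
      rcases eq_or_ne i m with rfl | him
      · nlinarith
      · have h1 := hsep i hi m hm him
        rw [max_eq_right (hmax i hi)] at h1
        have h2 := dist_triangle i.1 z m.1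
        have h3 := mem_ball'.1 (hz i hi)
        have h4 := mem_ball.1 (hz m hm)
        nlinarith [hpos i hi]
    intro i hi j hj hij
    refine ((hr i hi).trans ?_).trans (hsep i hi j hj hij)
    gcongr
    exact le_max_left _ _
  have hinj : Set.InjOn Prod.fst (S : Set (X × ℝ)) := by
    intro i hi j hj hij
    by_contra hne'
    have h1 := hsep' i hi j hj hne'
    rw [hij, dist_self] at h1
    nlinarith
  rw [← Finset.card_image_of_injOn hinj]
  refine hN z m.2 hR _ (fun y hy => ?_) fun y hy w hw hyw => ?_
  · obtain ⟨i, hi, rfl⟩ := Finset.mem_image.1 hy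
    exact mem_ball'.2 ((mem_ball.1 (hz i hi)).trans_le (hmax i hi))
  · obtain ⟨i, hi, rfl⟩ := Finset.mem_image.1 hy
    obtain ⟨j, hj, rfl⟩ := Finset.mem_image.1 hw
    exact hsep' i hi j hj fun h => hyw (by rw [h])

end Covering

section MaximalFunction

variable {X : Type*} [MetricSpace X] [MeasurableSpace X]

/-- A lower semicontinuous majorant of the modified Hardy-Littlewood maximal function: the centre
of the ball may move by a small multiple of the radius. -/
noncomputable def movingMax (μ : Measure X) (β : ℝ) (g : X → ℝ≥0∞) (x : X) : ℝ≥0∞ :=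
  ⨆ (y : X) (r : ℝ) (_ : 0 < r) (_ : x ∈ ball y ((β - 1) / 2 * r)),
    (μ (ball y (β * r)))⁻¹ * ∫⁻ z in ball y r, g z ∂μ

theorem lt_movingMax_iff {μ : Measure X} {β : ℝ} {g : X → ℝ≥0∞} {x : X} {t : ℝ≥0∞} :
    t < movingMax μ β g x ↔ ∃ (y : X) (r : ℝ), 0 < r ∧ x ∈ ball y ((β - 1) / 2 * r) ∧
      t < (μ (ball y (β * r)))⁻¹ * ∫⁻ z in ball y r, g z ∂μ := by
  simp only [movingMax, lt_iSup_iff, exists_prop]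

theorem average_le_movingMax {μ : Measure X} {β : ℝ} (hβ : 1 < β) (g : X → ℝ≥0∞) (x : X) {r : ℝ}
    (hr : 0 < r) :
    (μ (ball x (β * r)))⁻¹ * ∫⁻ z in ball x r, g z ∂μ ≤ movingMax μ β g x :=
  le_iSup_of_le x <| le_iSup_of_le r <| le_iSup_of_le hr <|
    le_iSup_of_le (mem_ball_self (by nlinarith)) le_rfl

theorem lowerSemicontinuous_movingMax (μ : Measure X) (β : ℝ) (g : X → ℝ≥0∞) :
    LowerSemicontinuous (movingMax μ β g) := by
  intro x t ht
  obtain ⟨y, r, hr, hx, ht⟩ := lt_movingMax_iff.1 ht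
  filter_upwards [isOpen_ball.mem_nhds hx] with z hz
  exact lt_movingMax_iff.2 ⟨y, r, hr, hz, ht⟩

theorem measurable_movingMax [BorelSpace X] (μ : Measure X) (β : ℝ) (g : X → ℝ≥0∞) :
    Measurable (movingMax μ β g) :=
  (lowerSemicontinuous_movingMax μ β g).measurable

/-- Functions integrate over finite families with overlap at most `N` to at most `N` times
the full integral. -/
theorem sum_setLIntegral_le_of_overlap {α ι : Type*} [MeasurableSpace α] {μ : Measure α}
    (S : Finset ι) (B : ι → Set α) (hB : ∀ i ∈ S, MeasurableSet (B i)) (N : ℕ)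
    (hN : ∀ z, ∀ S' ⊆ S, (∀ i ∈ S', z ∈ B i) → S'.card ≤ N) {g : α → ℝ≥0∞} (hg : Measurable g) :
    ∑ i ∈ S, ∫⁻ z in B i, g z ∂μ ≤ N * ∫⁻ z, g z ∂μ := by
  classical
  have h1 : ∀ i ∈ S, ∫⁻ z in B i, g z ∂μ = ∫⁻ z, (B i).indicator g z ∂μ := fun i hi =>
    (lintegral_indicator (hB i hi) g).symm
  rw [Finset.sum_congr rfl h1, ← lintegral_finsetSum _ fun i hi => hg.indicator (hB i hi),
    ← lintegral_const_mul _ hg]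
  refine lintegral_mono fun z => ?_
  simp only [Set.indicator_apply]
  rw [← Finset.sum_filter, Finset.sum_const, nsmul_eq_mul]
  gcongr
  exact hN z _ (Finset.filter_subset _ _) fun i hi => (Finset.mem_filter.1 hi).2

/-- Weak type `(1,1)` of the maximal function. -/
theorem GeomDoubling.exists_weak_type [BorelSpace X] {N₀ : ℕ} (hX : GeomDoubling X N₀)
    (μ : Measure X) {β : ℝ} (hβ : 1 < β) :
    ∃ N : ℕ, ∀ g : X → ℝ≥0∞, Measurable g → ∀ t : ℝ≥0∞,
      t * μ {x | t < movingMax μ β g x} ≤ N * ∫⁻ z, g z ∂μ := by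
  classical
  have := hX.secondCountableTopology
  have hb : 1 < (β + 1) / 2 := by linarith
  obtain ⟨N, hN⟩ := hX.exists_overlap_bound hb
  refine ⟨N, fun g hg t => ?_⟩
  let I : Set (X × ℝ) := {i | 0 < i.2 ∧
    t < (μ (ball i.1 (β * i.2)))⁻¹ * ∫⁻ z in ball i.1 i.2, g z ∂μ}
  let U : X × ℝ → Set X := fun i => ball i.1 ((β - 1) / 2 * i.2)
  have hE : {x | t < movingMax μ β g x} = ⋃ i ∈ I, U i := by
    ext x
    simp only [Set.mem_ofPred_eq, lt_movingMax_iff, Set.mem_iUnion, exists_prop, Prod.exists, I, U]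
    constructor
    · rintro ⟨y, r, hr, hx, ht⟩
      exact ⟨y, r, ⟨hr, ht⟩, hx⟩
    · rintro ⟨y, r, ⟨hr, ht⟩, hx⟩
      exact ⟨y, r, hr, hx, ht⟩
  obtain ⟨T, hTI, hTc, hTU⟩ := TopologicalSpace.isOpen_biUnion_countable I U
    fun i _ => isOpen_ball
  have hfin : ∀ F : Finset (X × ℝ), (↑F : Set (X × ℝ)) ⊆ I →
      t * μ (⋃ i ∈ F, U i) ≤ N * ∫⁻ z, g z ∂μ := by
    intro F hF
    obtain ⟨S, hSF, hsep, hcov⟩ := exists_separated_subfamily_s17 (zero_lt_one.trans hb) F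
      fun i hi => (hF hi).1
    have hsub : ⋃ i ∈ F, U i ⊆ ⋃ j ∈ S, ball j.1 (β * j.2) := by
      refine Set.iUnion₂_subset fun i hi x hx => ?_
      obtain ⟨j, hj, hij, hd⟩ := hcov i hi
      refine Set.mem_iUnion₂.2 ⟨j, hj, mem_ball.2 ?_⟩
      have h1 := mem_ball.1 hx
      have h2 := dist_triangle x i.1 j.1
      nlinarith
    have hterm : ∀ j ∈ S, t * μ (ball j.1 (β * j.2)) ≤ ∫⁻ z in ball j.1 j.2, g z ∂μ := by
      intro j hj
      have h := (hF (hSF hj)).2.le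
      rw [mul_comm, ← div_eq_mul_inv] at h
      exact ENNReal.mul_le_of_le_div h
    calc t * μ (⋃ i ∈ F, U i) ≤ t * ∑ j ∈ S, μ (ball j.1 (β * j.2)) := by
          gcongr
          exact (measure_mono hsub).trans (measure_biUnion_finset_le _ _)
      _ ≤ ∑ j ∈ S, ∫⁻ z in ball j.1 j.2, g z ∂μ := by
          rw [Finset.mul_sum]
          exact Finset.sum_le_sum hterm
      _ ≤ N * ∫⁻ z, g z ∂μ :=
          sum_setLIntegral_le_of_overlap S _ (fun _ _ => measurableSet_ball) N
            (fun z S' hS' hz => hN S' (fun i hi j hj => hsep i (hS' hi) j (hS' hj)) z hz) hg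
  have hunion : ⋃ i ∈ T, U i = ⋃ F : Finset T, ⋃ i ∈ F, U i := by
    ext x
    simp only [Set.mem_iUnion, exists_prop]
    constructor
    · rintro ⟨i, hi, hx⟩
      exact ⟨{⟨i, hi⟩}, ⟨i, hi⟩, by simp, hx⟩
    · rintro ⟨F, i, -, hx⟩
      exact ⟨i, i.2, hx⟩
  have := hTc.to_subtype
  have hmono : Monotone fun F : Finset T => ⋃ i ∈ F, U i := fun F G hFG =>
    Set.biUnion_subset_biUnion_left fun i hi => hFG hi
  rw [hE, ← hTU, hunion, hmono.directed_le.measure_iUnion, ENNReal.mul_iSup]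
  refine iSup_le fun F => ?_
  have h := hfin (F.image Subtype.val) fun i hi => by
    obtain ⟨j, -, rfl⟩ := Finset.mem_image.1 hi
    exact hTI j.2
  simpa only [Finset.set_biUnion_finset_image] using h

/-- `∫₀^∞ λ^{a-1} 𝟙[λ < t] dλ = t^a / a`. -/
theorem lintegral_rpow_indicator_lt {a : ℝ} (ha : 0 < a) (t : ℝ≥0∞) :
    ∫⁻ l in Set.Ioi (0 : ℝ), {l : ℝ | ENNReal.ofReal l < t}.indicator
      (fun l => ENNReal.ofReal (l ^ (a - 1))) l = t ^ a / ENNReal.ofReal a := by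
  have hmeas : ∀ t : ℝ≥0∞, MeasurableSet {l : ℝ | ENNReal.ofReal l < t} := fun t =>
    measurableSet_lt ENNReal.measurable_ofReal measurable_const
  have hfin : ∀ s : ℝ, 0 ≤ s → ∫⁻ l in Set.Ioi (0 : ℝ),
      {l : ℝ | ENNReal.ofReal l < ENNReal.ofReal s}.indicator
        (fun l => ENNReal.ofReal (l ^ (a - 1))) l =
          ENNReal.ofReal s ^ a / ENNReal.ofReal a := by
    intro s hs
    have hset : {l : ℝ | ENNReal.ofReal l < ENNReal.ofReal s} ∩ Set.Ioi 0 = Set.Ioo 0 s := by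
      ext l
      simp only [Set.mem_inter_iff, Set.mem_ofPred_eq, Set.mem_Ioi, Set.mem_Ioo]
      constructor
      · rintro ⟨h, hl⟩
        exact ⟨hl, (ENNReal.ofReal_lt_ofReal_iff_of_nonneg hl.le).1 h⟩
      · rintro ⟨hl, h⟩
        exact ⟨(ENNReal.ofReal_lt_ofReal_iff_of_nonneg hl.le).2 h, hl⟩
    rw [lintegral_indicator (hmeas _), Measure.restrict_restrict (hmeas _), hset,
      restrict_Ioo_eq_restrict_Ioc]
    have hint : IntervalIntegrable (fun l : ℝ => l ^ (a - 1)) volume 0 s :=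
      intervalIntegral.intervalIntegrable_rpow' (by linarith)
    rw [← ofReal_integral_eq_lintegral_ofReal
      ((intervalIntegrable_iff_integrableOn_Ioc_of_le hs).1 hint),
      ← intervalIntegral.integral_of_le hs, integral_rpow (Or.inl (by linarith)),
      sub_add_cancel, Real.zero_rpow ha.ne', sub_zero, ENNReal.ofReal_div_of_pos ha,
      ENNReal.ofReal_rpow_of_nonneg hs ha.le]
    filter_upwards [ae_restrict_mem measurableSet_Ioc] with l hl
    exact Real.rpow_nonneg hl.1.le _
  rcases eq_or_ne t ⊤ with rfl | ht
  · rw [ENNReal.top_rpow_of_pos ha, ENNReal.top_div_of_ne_top ENNReal.ofReal_ne_top]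
    refine ENNReal.eq_top_of_forall_nnreal_le fun s => ?_
    have hs := hfin ((s * ENNReal.ofReal a) ^ (1 / a)).toReal ENNReal.toReal_nonneg
    rw [ENNReal.ofReal_toReal (by finiteness), ← ENNReal.rpow_mul, one_div_mul_cancel ha.ne',
      ENNReal.rpow_one, ENNReal.mul_div_cancel_right (by simpa using ha) ENNReal.ofReal_ne_top] at hs
    rw [← hs]
    gcongr
    exact le_top
  · have := hfin t.toReal ENNReal.toReal_nonneg
    rwa [ENNReal.ofReal_toReal ht] at this

/-- Layer-cake formula for `ℝ≥0∞`-valued functions. -/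
theorem lintegral_rpow_eq_lintegral_meas_lt {α : Type*} [MeasurableSpace α] {μ : Measure α}
    [SFinite μ] {a : ℝ} (ha : 0 < a) {h : α → ℝ≥0∞} (hh : Measurable h) (w : α → ℝ≥0∞)
    (hw : Measurable w) :
    ∫⁻ x, w x * (h x ^ a / ENNReal.ofReal a) ∂μ =
      ∫⁻ l in Set.Ioi (0 : ℝ), ENNReal.ofReal (l ^ (a - 1)) *
        ∫⁻ x in {x | ENNReal.ofReal l < h x}, w x ∂μ := by
  have hset : MeasurableSet {z : α × ℝ | ENNReal.ofReal z.2 < h z.1} :=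
    measurableSet_lt (ENNReal.measurable_ofReal.comp measurable_snd) (hh.comp measurable_fst)
  have hpow : Measurable fun l : ℝ => ENNReal.ofReal (l ^ (a - 1)) := by fun_prop
  have hF : Measurable (Function.uncurry fun (x : α) (l : ℝ) =>
      {z : α × ℝ | ENNReal.ofReal z.2 < h z.1}.indicator
        (fun z => w z.1 * ENNReal.ofReal (z.2 ^ (a - 1))) (x, l)) :=
    ((hw.comp measurable_fst).mul (hpow.comp measurable_snd)).indicator hset
  have hl : ∀ l : ℝ, MeasurableSet {x | ENNReal.ofReal l < h x} := fun l =>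
    measurableSet_lt measurable_const hh
  have hx : ∀ t : ℝ≥0∞, MeasurableSet {l : ℝ | ENNReal.ofReal l < t} := fun t =>
    measurableSet_lt ENNReal.measurable_ofReal measurable_const
  calc ∫⁻ x, w x * (h x ^ a / ENNReal.ofReal a) ∂μ
      = ∫⁻ x, (∫⁻ l in Set.Ioi (0 : ℝ), {z : α × ℝ | ENNReal.ofReal z.2 < h z.1}.indicator
        (fun z => w z.1 * ENNReal.ofReal (z.2 ^ (a - 1))) (x, l)) ∂μ := by
        refine lintegral_congr fun x => ?_
        rw [← lintegral_rpow_indicator_lt ha, ← lintegral_const_mul _ (hpow.indicator (hx _))]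
        refine lintegral_congr fun l => ?_
        simp only [Set.indicator_apply, Set.mem_ofPred_eq, mul_ite, mul_zero]
    _ = _ := by
        rw [lintegral_lintegral_swap hF.aemeasurable]
        refine lintegral_congr fun l => ?_
        rw [← lintegral_indicator (hl l), ← lintegral_const_mul _ (hw.indicator (hl l))]
        refine lintegral_congr fun x => ?_
        rw [mul_comm (ENNReal.ofReal (l ^ (a - 1)))]
        simp only [Set.indicator_apply, Set.mem_ofPred_eq, ite_mul, zero_mul]

/-- Lowering the function at height `t` costs at most `t` in the maximal function. -/
theorem movingMax_le_add [OpensMeasurableSpace X] {μ : Measure X} {β : ℝ} (hβ : 1 < β)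
    {g : X → ℝ≥0∞} (hg : Measurable g) (t : ℝ≥0∞) (x : X) :
    movingMax μ β g x ≤ movingMax μ β ({z | t < g z}.indicator g) x + t := by
  refine iSup_le fun y => iSup_le fun r => iSup_le fun hr => iSup_le fun hx => ?_
  have hset : MeasurableSet {z | t < g z} := measurableSet_lt measurable_const hg
  have h1 : ∫⁻ z in ball y r, g z ∂μ ≤
      ∫⁻ z in ball y r, {z | t < g z}.indicator g z ∂μ + t * μ (ball y (β * r)) := by
    calc ∫⁻ z in ball y r, g z ∂μ
        ≤ ∫⁻ z in ball y r, ({z | t < g z}.indicator g z + t) ∂μ := by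
          refine lintegral_mono fun z => ?_
          by_cases hz : t < g z
          · rw [Set.indicator_of_mem (show z ∈ {z | t < g z} from hz)]
            exact le_self_add
          · exact (not_lt.1 hz).trans le_add_self
      _ = ∫⁻ z in ball y r, {z | t < g z}.indicator g z ∂μ + t * μ (ball y r) := by
          rw [lintegral_add_right _ measurable_const, setLIntegral_const]
      _ ≤ _ := by
          gcongr
          nlinarith
  calc (μ (ball y (β * r)))⁻¹ * ∫⁻ z in ball y r, g z ∂μ
      ≤ (μ (ball y (β * r)))⁻¹ * (∫⁻ z in ball y r, {z | t < g z}.indicator g z ∂μ +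
          t * μ (ball y (β * r))) := by gcongr
    _ = (μ (ball y (β * r)))⁻¹ * ∫⁻ z in ball y r, {z | t < g z}.indicator g z ∂μ +
          t * ((μ (ball y (β * r)))⁻¹ * μ (ball y (β * r))) := by ring
    _ ≤ movingMax μ β ({z | t < g z}.indicator g) x + t := by
        refine add_le_add ?_ (mul_le_of_le_one_right' (ENNReal.inv_mul_le_one _))
        exact le_iSup_of_le y <| le_iSup_of_le r <| le_iSup_of_le hr <| le_iSup_of_le hx le_rfl

/-- Strong type `(p,p)` of the maximal function. -/
theorem GeomDoubling.exists_strong_type [BorelSpace X] {N₀ : ℕ} (hX : GeomDoubling X N₀)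
    (μ : Measure X) [SFinite μ] {β p : ℝ} (hβ : 1 < β) (hp : 1 < p) :
    ∃ C : ℝ≥0∞, C ≠ ⊤ ∧ ∀ g : X → ℝ≥0∞, Measurable g →
      ∫⁻ x, movingMax μ β g x ^ p ∂μ ≤ C * ∫⁻ x, g x ^ p ∂μ := by
  obtain ⟨N, hN⟩ := hX.exists_weak_type μ hβ
  have hp0 : 0 < p := zero_lt_one.trans hp
  have hp1 : 0 < p - 1 := sub_pos.2 hp
  refine ⟨ENNReal.ofReal p * (2 * N) * (2 ^ (p - 1) / ENNReal.ofReal (p - 1)), ?_,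
    fun g hg => ?_⟩
  · have : ENNReal.ofReal (p - 1) ≠ 0 := by simpa using hp
    finiteness
  have hweak : ∀ l : ℝ, 0 < l → μ {x | ENNReal.ofReal l < movingMax μ β g x} ≤
      ENNReal.ofReal (l⁻¹) * (2 * N) * ∫⁻ x in {x | ENNReal.ofReal l < 2 * g x}, g x ∂μ := by
    intro l hl
    set t : ℝ≥0∞ := ENNReal.ofReal (l / 2) with ht
    have ht0 : t ≠ 0 := by simpa [ht] using hl
    have htop : t ≠ ⊤ := ENNReal.ofReal_ne_top
    have h2t : ENNReal.ofReal l = 2 * t := by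
      rw [ht, ENNReal.ofReal_div_of_pos two_pos, ENNReal.ofReal_ofNat,
        ENNReal.mul_div_cancel (by norm_num) (by norm_num)]
    have hset : {x | ENNReal.ofReal l < 2 * g x} = {x | t < g x} := by
      ext x
      simp only [Set.mem_ofPred_eq, h2t]
      exact ENNReal.mul_lt_mul_iff_right (by norm_num) (by norm_num)
    have hm : MeasurableSet {x | t < g x} := measurableSet_lt measurable_const hg
    have hsub : {x | ENNReal.ofReal l < movingMax μ β g x} ⊆
        {x | t < movingMax μ β ({z | t < g z}.indicator g) x} := by
      intro x hx
      have h := lt_of_lt_of_le hx (movingMax_le_add hβ hg t x)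
      rw [h2t, two_mul] at h
      exact lt_of_add_lt_add_right h
    have hw := hN _ (hg.indicator hm) t
    rw [lintegral_indicator hm] at hw
    have hinv : ENNReal.ofReal l⁻¹ * 2 = t⁻¹ := by
      rw [ENNReal.ofReal_inv_of_pos hl, h2t, ENNReal.mul_inv (by simp) (by simp), mul_right_comm,
        ENNReal.inv_mul_cancel (by norm_num) (by norm_num), one_mul]
    rw [hset, ← mul_assoc, hinv, mul_assoc]
    refine (measure_mono hsub).trans ?_
    rw [mul_comm t⁻¹, ← div_eq_mul_inv, ENNReal.le_div_iff_mul_le (Or.inl ht0) (Or.inl htop),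
      mul_comm]
    exact hw
  have hlc := lintegral_rpow_eq_lintegral_meas_lt (μ := μ) hp0 (measurable_movingMax μ β g)
    (fun _ => ENNReal.ofReal p) measurable_const
  have hpp : ENNReal.ofReal p ≠ 0 := by simpa using hp0
  simp only [ENNReal.mul_div_cancel hpp ENNReal.ofReal_ne_top, setLIntegral_const] at hlc
  rw [hlc]
  have hlc' := lintegral_rpow_eq_lintegral_meas_lt (μ := μ) hp1 (hg.const_mul 2) g hg
  have hpow : ∀ x, g x * ((2 * g x) ^ (p - 1) / ENNReal.ofReal (p - 1)) =
      2 ^ (p - 1) / ENNReal.ofReal (p - 1) * g x ^ p := by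
    intro x
    have : g x ^ p = g x * g x ^ (p - 1) := by
      conv_rhs => rw [← ENNReal.rpow_one (g x), ← ENNReal.rpow_mul, one_mul,
        ← ENNReal.rpow_add_of_nonneg _ _ zero_le_one hp1.le, add_sub_cancel]
    rw [ENNReal.mul_rpow_of_nonneg _ _ hp1.le, this, div_eq_mul_inv, div_eq_mul_inv]
    ring
  simp only [hpow] at hlc'
  rw [lintegral_const_mul _ (hg.pow_const p)] at hlc'
  rw [mul_assoc _ (2 ^ (p - 1) / _), hlc', ← lintegral_const_mul' _ _ (by finiteness)]
  refine setLIntegral_mono' measurableSet_Ioi fun l hl => ?_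
  have hl0 : (0 : ℝ) < l := hl
  calc ENNReal.ofReal (l ^ (p - 1)) *
        (ENNReal.ofReal p * μ {x | ENNReal.ofReal l < movingMax μ β g x})
      ≤ ENNReal.ofReal (l ^ (p - 1)) * (ENNReal.ofReal p * (ENNReal.ofReal (l⁻¹) * (2 * N) *
          ∫⁻ x in {x | ENNReal.ofReal l < 2 * g x}, g x ∂μ)) := by
        gcongr
        exact hweak l hl0
    _ = ENNReal.ofReal p * (2 * N) * (ENNReal.ofReal (l ^ (p - 1)) * ENNReal.ofReal (l⁻¹) *
          ∫⁻ x in {x | ENNReal.ofReal l < 2 * g x}, g x ∂μ) := by ring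
    _ = _ := by
        rw [← ENNReal.ofReal_mul (by positivity), ← Real.rpow_neg_one l, ← Real.rpow_add hl0,
          ← sub_eq_add_neg]

end MaximalFunction

section Morrey

theorem ennreal_rpow_le_rpow_of_nonpos {x y : ℝ≥0∞} {u : ℝ} (hu : u ≤ 0) (h : x ≤ y) :
    y ^ u ≤ x ^ u := by
  rw [← neg_neg u, ENNReal.rpow_neg y, ENNReal.rpow_neg x]
  exact ENNReal.inv_le_inv.2 (ENNReal.rpow_le_rpow h (neg_nonneg.2 hu))

theorem setLIntegral_le_sum_inter {α ι : Type*} [MeasurableSpace α] {μ : Measure α} {A : Set α}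
    {s : Finset ι} {B : ι → Set α} (h : A ⊆ ⋃ i ∈ s, B i) (F : α → ℝ≥0∞) :
    ∫⁻ x in A, F x ∂μ ≤ ∑ i ∈ s, ∫⁻ x in A ∩ B i, F x ∂μ := by
  have hsub : A ⊆ ⋃ i : s, A ∩ B i := fun x hx => by
    obtain ⟨i, hi, hxi⟩ := Set.mem_iUnion₂.1 (h hx)
    exact Set.mem_iUnion.2 ⟨⟨i, hi⟩, hx, hxi⟩
  refine (lintegral_mono_set hsub).trans ((lintegral_iUnion_le _ _).trans ?_)
  rw [tsum_fintype]
  exact (Finset.sum_coe_sort s fun i => ∫⁻ x in A ∩ B i, F x ∂μ).le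

/-- Modified Morrey norms with different enlargement parameters are comparable. -/
theorem GeomDoubling.exists_change_parameter {X : Type*} [MetricSpace X] [MeasurableSpace X]
    {N₀ : ℕ} (hX : GeomDoubling X N₀) (μ : Measure X) {k β u : ℝ} (hk : 0 < k) (hβ : 1 < β)
    (hu : u ≤ 0) :
    ∃ N : ℕ, ∀ (h : X → ℝ≥0∞) (P : ℝ≥0∞),
      (∀ x r, 0 < r → μ (ball x (k * r)) ^ u * ∫⁻ z in ball x r, h z ∂μ ≤ P) →
      ∀ x r, 0 < r → μ (ball x (β * r)) ^ u * ∫⁻ z in ball x r, h z ∂μ ≤ N * P := by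
  have hδ : 0 < (β - 1) / k := div_pos (sub_pos.2 hβ) hk
  obtain ⟨N, hN⟩ := hX.exists_cover_s17 hδ
  refine ⟨N, fun h P hP x r hr => ?_⟩
  obtain ⟨s, hs, hcard, hcov⟩ := hN x r hr
  calc μ (ball x (β * r)) ^ u * ∫⁻ z in ball x r, h z ∂μ
      ≤ μ (ball x (β * r)) ^ u * ∑ y ∈ s, ∫⁻ z in ball y ((β - 1) / k * r), h z ∂μ := by
        gcongr
        refine (setLIntegral_le_sum_inter hcov h).trans (Finset.sum_le_sum fun y _ => ?_)
        exact lintegral_mono_set Set.inter_subset_right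
    _ ≤ ∑ y ∈ s, P := by
        rw [Finset.mul_sum]
        refine Finset.sum_le_sum fun y hy => le_trans ?_ (hP y ((β - 1) / k * r) (by positivity))
        refine mul_le_mul_left (ennreal_rpow_le_rpow_of_nonpos hu (measure_mono ?_)) _
        refine ball_subset_ball' ?_
        have h1 : k * ((β - 1) / k * r) = (β - 1) * r := by field_simp
        have h2 := mem_ball.1 (hs hy)
        rw [h1]
        linarith
    _ ≤ N * P := by
        rw [Finset.sum_const, nsmul_eq_mul]
        gcongr

/-- Hölder's inequality bounds averages by the terms of the Morrey norm. -/
theorem measure_rpow_mul_setLIntegral_le {α : Type*} [MeasurableSpace α] {μ : Measure α}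
    {p q : ℝ} (hp : 1 < p) (hpq : p ≤ q) {g : α → ℝ≥0∞} (hg : Measurable g) {B B' : Set α}
    (hB : B ⊆ B') {Q : ℝ≥0∞} (hQ : μ B' ^ (p / q - 1) * ∫⁻ x in B, g x ^ p ∂μ ≤ Q) :
    μ B' ^ (1 / q - 1) * ∫⁻ x in B, g x ∂μ ≤ Q ^ (1 / p) := by
  have hp0 : 0 < p := zero_lt_one.trans hp
  have hq : 1 < q := hp.trans_le hpq
  have hq' : 1 / q - 1 < 0 := sub_neg.2 ((div_lt_one (by linarith)).2 hq)
  have hp' : 0 < 1 - 1 / p := sub_pos.2 ((div_lt_one hp0).2 hp)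
  rcases eq_or_ne (μ B') 0 with h0 | h0
  · rw [setLIntegral_measure_zero _ _ (measure_mono_null hB h0), mul_zero]
    exact zero_le
  rcases eq_or_ne (μ B') ⊤ with ht | ht
  · rw [ht, ENNReal.top_rpow_of_neg hq', zero_mul]
    exact zero_le
  have hconj := Real.HolderConjugate.conjExponent hp
  have hholder := ENNReal.lintegral_mul_le_Lp_mul_Lq (μ.restrict B) hconj hg.aemeasurable
    (aemeasurable_const (b := (1 : ℝ≥0∞)))
  have hexp : 1 / p.conjExponent = 1 - 1 / p := by
    rw [one_div, one_div]
    exact hconj.one_sub_inv.symm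
  simp only [Pi.mul_apply, mul_one, ENNReal.one_rpow, lintegral_const, one_mul,
    Measure.restrict_apply_univ, hexp] at hholder
  calc μ B' ^ (1 / q - 1) * ∫⁻ x in B, g x ∂μ
      ≤ μ B' ^ (1 / q - 1) * ((∫⁻ x in B, g x ^ p ∂μ) ^ (1 / p) * μ B' ^ (1 - 1 / p)) := by
        gcongr
        refine hholder.trans ?_
        gcongr
    _ = (μ B' ^ (1 / q - 1) * μ B' ^ (1 - 1 / p)) * (∫⁻ x in B, g x ^ p ∂μ) ^ (1 / p) := by ring
    _ = (μ B' ^ (p / q - 1) * ∫⁻ x in B, g x ^ p ∂μ) ^ (1 / p) := by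
        rw [← ENNReal.rpow_add _ _ h0 ht, ENNReal.mul_rpow_of_nonneg _ _ (by positivity),
          ← ENNReal.rpow_mul]
        congr 2
        have : q ≠ 0 := by linarith
        field_simp
        ring
    _ ≤ Q ^ (1 / p) := by gcongr

/-- Hedberg's interpolation between the fractional and the ordinary average. -/
theorem rpow_mul_le_hedberg {m I D : ℝ≥0∞} {q α : ℝ} (hq : 1 < q) (hα0 : 0 < α)
    (hαq : α < 1 / q) (hm : m = 0 → I = 0) (hD : m ^ (1 / q - 1) * I ≤ D) :
    m ^ (α - 1) * I ≤ D ^ (α * q) * (m⁻¹ * I) ^ (1 - α * q) := by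
  have hq0 : 0 < q := zero_lt_one.trans hq
  have hθ : 0 < 1 - α * q := sub_pos.2 ((lt_div_iff₀ hq0).1 hαq)
  have hα1 : α - 1 < 0 := by
    have : 1 / q < 1 := (div_lt_one hq0).2 hq
    linarith
  rcases eq_or_ne m 0 with h0 | h0
  · rw [hm h0, mul_zero]
    exact zero_le
  rcases eq_or_ne m ⊤ with ht | ht
  · rw [ht, ENNReal.top_rpow_of_neg hα1, zero_mul]
    exact zero_le
  have hI : I = I ^ (α * q) * I ^ (1 - α * q) := by
    rw [← ENNReal.rpow_add_of_nonneg _ _ (by positivity) hθ.le, add_sub_cancel, ENNReal.rpow_one]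
  have hmm : m ^ (α - 1) = (m ^ (1 / q - 1)) ^ (α * q) * m⁻¹ ^ (1 - α * q) := by
    rw [← ENNReal.rpow_neg_one, ← ENNReal.rpow_mul, ← ENNReal.rpow_mul,
      ← ENNReal.rpow_add _ _ h0 ht]
    congr 1
    field_simp
    ring
  calc m ^ (α - 1) * I
      = (m ^ (1 / q - 1) * I) ^ (α * q) * (m⁻¹ * I) ^ (1 - α * q) := by
        rw [ENNReal.mul_rpow_of_nonneg _ _ (by positivity), ENNReal.mul_rpow_of_nonneg _ _ hθ.le,
          hmm]
        nth_rewrite 1 [hI]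
        ring
    _ ≤ _ := by gcongr

variable {X : Type*} [MetricSpace X] [MeasurableSpace X]

/-- Averages over small balls only see the localized function, those over large balls are
controlled by the size of the function. -/
theorem average_le_max_movingMax [OpensMeasurableSpace X] {μ : Measure X} {β q κ δ : ℝ}
    (hβ : 1 < β) (hq : 1 < q) (hδ : 2 * δ ≤ κ - 1)
    {g : X → ℝ≥0∞} {D : ℝ≥0∞}
    (hD : ∀ x s, 0 < s → μ (ball x (β * s)) ^ (1 / q - 1) * ∫⁻ z in ball x s, g z ∂μ ≤ D)
    {x x₀ y : X} {r s : ℝ} (hr : 0 < r) (hs : 0 < s) (hx : x ∈ ball x₀ r)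
    (hxy : x ∈ ball y (δ * r)) :
    (μ (ball x (β * s)))⁻¹ * ∫⁻ z in ball x s, g z ∂μ ≤
      max (movingMax μ β ((ball x₀ (κ * r)).indicator g) x)
        (D * μ (ball y (δ * r)) ^ (-1 / q)) := by
  rcases le_or_gt s ((κ - 1) * r) with hsr | hsr
  · have hsub : ball x s ⊆ ball x₀ (κ * r) := ball_subset_ball' (by
      have := mem_ball.1 hx
      linarith)
    refine le_max_of_le_left (le_trans ?_ (average_le_movingMax hβ _ x hs))
    refine mul_le_mul_right (le_of_eq ?_) _
    refine setLIntegral_congr_fun measurableSet_ball fun z hz => ?_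
    exact (Set.indicator_of_mem (hsub hz) g).symm
  · refine le_max_of_le_right ?_
    have hsub : ball y (δ * r) ⊆ ball x (β * s) := ball_subset_ball' (by
      have h1 := mem_ball'.1 hxy
      have h2 : 2 * (δ * r) ≤ (κ - 1) * r := by nlinarith
      nlinarith)
    have hq0 : 0 < q := zero_lt_one.trans hq
    have hneg : -1 / q ≤ 0 := div_nonpos_of_nonpos_of_nonneg (by norm_num) hq0.le
    rcases eq_or_ne (μ (ball x (β * s))) 0 with h0 | h0
    · rw [setLIntegral_measure_zero _ _
        (measure_mono_null (ball_subset_ball (by nlinarith)) h0), mul_zero]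
      exact zero_le
    rcases eq_or_ne (μ (ball x (β * s))) ⊤ with ht | ht
    · rw [ht, ENNReal.inv_top, zero_mul]
      exact zero_le
    calc (μ (ball x (β * s)))⁻¹ * ∫⁻ z in ball x s, g z ∂μ
        = (μ (ball x (β * s)) ^ (1 / q - 1) * ∫⁻ z in ball x s, g z ∂μ) *
            μ (ball x (β * s)) ^ (-1 / q) := by
          rw [mul_right_comm, ← ENNReal.rpow_add _ _ h0 ht, ← ENNReal.rpow_neg_one]
          congr 2
          ring
      _ ≤ _ := mul_le_mul' (hD x s hs) (ennreal_rpow_le_rpow_of_nonpos hneg (measure_mono hsub))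

theorem rpow_mul_measure_le {m n D : ℝ≥0∞} {p q : ℝ} (hp : 0 < p) (hpq : p ≤ q) (hnm : n ≤ m) :
    m ^ (p / q - 1) * ((D * n ^ (-1 / q)) ^ p * n) ≤ D ^ p := by
  have hq : 0 < q := hp.trans_le hpq
  have hu : p / q - 1 ≤ 0 := sub_nonpos.2 ((div_le_one hq).2 hpq)
  rcases eq_or_ne n 0 with h0 | h0
  · rw [h0, mul_zero, mul_zero]
    exact zero_le
  rcases eq_or_ne n ⊤ with ht | ht
  · rw [ht, ENNReal.top_rpow_of_neg (div_neg_of_neg_of_pos (by norm_num) hq), mul_zero,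
      ENNReal.zero_rpow_of_pos hp, zero_mul, mul_zero]
    exact zero_le
  calc m ^ (p / q - 1) * ((D * n ^ (-1 / q)) ^ p * n)
      ≤ n ^ (p / q - 1) * ((D * n ^ (-1 / q)) ^ p * n) := by
        exact mul_le_mul_left (ennreal_rpow_le_rpow_of_nonpos hu hnm) _
    _ = D ^ p * (n ^ (p / q - 1) * n ^ (-1 / q * p) * n ^ (1 : ℝ)) := by
        rw [ENNReal.mul_rpow_of_nonneg _ _ hp.le, ← ENNReal.rpow_mul, ENNReal.rpow_one]
        ring
    _ = D ^ p := by
        rw [← ENNReal.rpow_add _ _ h0 ht, ← ENNReal.rpow_add _ _ h0 ht]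
        have : p / q - 1 + -1 / q * p + 1 = 0 := by ring
        rw [this, ENNReal.rpow_zero, mul_one]

theorem isLocallyFiniteMeasure_of_regular [BorelSpace X] (μ : Measure X) [μ.Regular] :
    IsLocallyFiniteMeasure μ := by
  refine ⟨fun x => ?_⟩
  obtain ⟨U, hxU, hU, hlt⟩ := ({x} : Set X).exists_isOpen_lt_of_lt (μ := μ) ⊤
    isCompact_singleton.measure_lt_top
  exact ⟨U, hU.mem_nhds (hxU rfl), hlt⟩

/-- The `p̃`-power form of the Morrey estimate for the fractional maximal operator. -/
theorem GeomDoubling.exists_fracMax_bound [BorelSpace X] {N₀ : ℕ} (hX : GeomDoubling X N₀)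
    (μ : Measure X) [SFinite μ] {p q β k α : ℝ} (hp : 1 < p) (hpq : p ≤ q) (hβ : 1 < β)
    (hk : 1 < k) (hα0 : 0 < α) (hαq : α < 1 / q) :
    ∃ C : ℝ≥0∞, C ≠ ⊤ ∧ ∀ (f : X → ℝ), Measurable f → ∀ P : ℝ≥0∞,
      (∀ x r, 0 < r →
        μ (ball x (k * r)) ^ (p / q - 1) * ∫⁻ z in ball x r, (‖f z‖₊ : ℝ≥0∞) ^ p ∂μ ≤ P) →
      ∀ x r, 0 < r → μ (ball x (k * r)) ^ (p / q - 1) *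
        ∫⁻ z in ball x r, modFracMax μ α β f z ^ (p / (1 - α * q)) ∂μ ≤
          C * P ^ (1 / (1 - α * q)) := by
  have hp0 : 0 < p := zero_lt_one.trans hp
  have hq : 1 < q := hp.trans_le hpq
  have hq0 : 0 < q := zero_lt_one.trans hq
  have hu : p / q - 1 ≤ 0 := sub_nonpos.2 ((div_le_one hq0).2 hpq)
  set θ := 1 - α * q with hθdef
  have hθ : 0 < θ := sub_pos.2 ((lt_div_iff₀ hq0).1 hαq)
  set κ := (k + 1) / 2 with hκdef
  have hκ : 1 < κ := by rw [hκdef]; linarith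
  have hκk : 1 < k / κ := (one_lt_div (by linarith)).2 (by rw [hκdef]; linarith)
  set δ := (κ - 1) / 2 with hδdef
  have hδ : 0 < δ := by rw [hδdef]; linarith
  obtain ⟨C, hC, hstrong⟩ := hX.exists_strong_type μ hβ hp
  obtain ⟨N₁, hN₁⟩ := hX.exists_change_parameter μ (zero_lt_one.trans hk) hκk hu
  obtain ⟨N₂, hN₂⟩ := hX.exists_change_parameter μ (zero_lt_one.trans hk) hβ hu
  obtain ⟨N₃, hN₃⟩ := hX.exists_cover_s17 hδ
  refine ⟨N₃ * ((N₂ : ℝ≥0∞) ^ (α * q / θ) * (C * N₁ + N₂)), ?_, fun f hf P hP x₀ r hr => ?_⟩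
  · have : (0 : ℝ) ≤ α * q / θ := by positivity
    finiteness
  set g : X → ℝ≥0∞ := fun z => (‖f z‖₊ : ℝ≥0∞) with hgdef
  have hg : Measurable g := by fun_prop
  set D : ℝ≥0∞ := (N₂ * P) ^ (1 / p) with hDdef
  have hDp : D ^ p = N₂ * P := by
    rw [hDdef, ← ENNReal.rpow_mul, one_div_mul_cancel hp0.ne', ENNReal.rpow_one]
  have hD : ∀ x s, 0 < s → μ (ball x (β * s)) ^ (1 / q - 1) * ∫⁻ z in ball x s, g z ∂μ ≤ D :=
    fun x s hs => measure_rpow_mul_setLIntegral_le hp hpq hg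
      (ball_subset_ball (by nlinarith)) (hN₂ _ P hP x s hs)
  set m := μ (ball x₀ (k * r)) with hm
  set G := movingMax μ β ((ball x₀ (κ * r)).indicator g) with hG
  have hGm : Measurable G := measurable_movingMax μ β _
  let K : X → ℝ≥0∞ := fun y => D * μ (ball y (δ * r)) ^ (-1 / q)
  have hpoint : ∀ y, ∀ x ∈ ball x₀ r ∩ ball y (δ * r),
      modFracMax μ α β f x ^ (p / θ) ≤ D ^ (α * q * (p / θ)) * (G x ^ p + K y ^ p) := by
    rintro y x ⟨hx, hxy⟩
    have h1 : modFracMax μ α β f x ≤ D ^ (α * q) * (max (G x) (K y)) ^ θ := by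
      refine iSup_le fun s => iSup_le fun hs => ?_
      refine (rpow_mul_le_hedberg hq hα0 hαq (fun h0 => ?_) (hD x s hs)).trans ?_
      · exact setLIntegral_measure_zero _ _
          (measure_mono_null (ball_subset_ball (by nlinarith)) h0)
      · gcongr
        exact average_le_max_movingMax hβ hq (by rw [hδdef]; linarith) hD hr hs hx hxy
    calc modFracMax μ α β f x ^ (p / θ)
        ≤ (D ^ (α * q) * (max (G x) (K y)) ^ θ) ^ (p / θ) := by gcongr
      _ = D ^ (α * q * (p / θ)) * (max (G x) (K y)) ^ p := by
          rw [ENNReal.mul_rpow_of_nonneg _ _ (by positivity), ← ENNReal.rpow_mul,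
            ← ENNReal.rpow_mul (max _ _), mul_div_cancel₀ _ hθ.ne']
      _ ≤ _ := by
          gcongr
          rcases le_total (G x) (K y) with h | h
          · rw [max_eq_right h]
            exact le_add_self
          · rw [max_eq_left h]
            exact le_self_add
  have hlocal : m ^ (p / q - 1) * ∫⁻ x, G x ^ p ∂μ ≤ C * N₁ * P := by
    have h1 : ∫⁻ x, (ball x₀ (κ * r)).indicator g x ^ p ∂μ =
        ∫⁻ x in ball x₀ (κ * r), g x ^ p ∂μ := by
      rw [← lintegral_indicator measurableSet_ball]
      refine lintegral_congr fun x => ?_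
      by_cases hx : x ∈ ball x₀ (κ * r)
      · simp only [Set.indicator_of_mem hx]
      · simp only [Set.indicator_of_notMem hx, ENNReal.zero_rpow_of_pos hp0]
    have h2 := hN₁ _ P hP x₀ (κ * r) (by positivity)
    rw [← mul_assoc, div_mul_cancel₀ _ (by linarith : κ ≠ 0)] at h2
    calc m ^ (p / q - 1) * ∫⁻ x, G x ^ p ∂μ
        ≤ m ^ (p / q - 1) * (C * ∫⁻ x in ball x₀ (κ * r), g x ^ p ∂μ) := by
          rw [← h1]
          gcongr
          exact hstrong _ (hg.indicator measurableSet_ball)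
      _ = C * (m ^ (p / q - 1) * ∫⁻ x in ball x₀ (κ * r), g x ^ p ∂μ) := by ring
      _ ≤ C * N₁ * P := by
          rw [mul_assoc]
          gcongr
  obtain ⟨s, hs, hcard, hcov⟩ := hN₃ x₀ r hr
  have hpiece : ∀ y ∈ s, m ^ (p / q - 1) *
      ∫⁻ x in ball x₀ r ∩ ball y (δ * r), modFracMax μ α β f x ^ (p / θ) ∂μ ≤
        D ^ (α * q * (p / θ)) * (C * N₁ * P + N₂ * P) := by
    intro y hy
    have hsub : ball y (δ * r) ⊆ ball x₀ (k * r) := ball_subset_ball' (by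
      have h1 := mem_ball.1 (hs hy)
      have h2 : δ + 1 ≤ k := by rw [hδdef, hκdef]; linarith
      nlinarith)
    calc m ^ (p / q - 1) *
          ∫⁻ x in ball x₀ r ∩ ball y (δ * r), modFracMax μ α β f x ^ (p / θ) ∂μ
        ≤ m ^ (p / q - 1) * ∫⁻ x in ball x₀ r ∩ ball y (δ * r),
            D ^ (α * q * (p / θ)) * (G x ^ p + K y ^ p) ∂μ := by
          refine mul_le_mul_right ?_ _
          exact setLIntegral_mono' (measurableSet_ball.inter measurableSet_ball) (hpoint y)
      _ = m ^ (p / q - 1) * (D ^ (α * q * (p / θ)) *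
            (∫⁻ x in ball x₀ r ∩ ball y (δ * r), G x ^ p ∂μ +
              K y ^ p * μ (ball x₀ r ∩ ball y (δ * r)))) := by
          rw [lintegral_const_mul _ ((hGm.pow_const p).add_const _),
            lintegral_add_right _ measurable_const, setLIntegral_const]
      _ ≤ m ^ (p / q - 1) * (D ^ (α * q * (p / θ)) *
            (∫⁻ x, G x ^ p ∂μ + K y ^ p * μ (ball y (δ * r)))) := by
          gcongr
          · exact Measure.restrict_le_self
          · exact Set.inter_subset_right
      _ = D ^ (α * q * (p / θ)) * (m ^ (p / q - 1) * ∫⁻ x, G x ^ p ∂μ +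
            m ^ (p / q - 1) * (K y ^ p * μ (ball y (δ * r)))) := by ring
      _ ≤ _ := by
          refine mul_le_mul_right (add_le_add hlocal ?_) _
          exact (rpow_mul_measure_le hp0 hpq (measure_mono hsub)).trans hDp.le
  have hDP : D ^ (α * q * (p / θ)) = (N₂ : ℝ≥0∞) ^ (α * q / θ) * P ^ (α * q / θ) := by
    rw [hDdef, ← ENNReal.rpow_mul, ← ENNReal.mul_rpow_of_nonneg _ _ (by positivity)]
    congr 1
    field_simp
  have hPP : P ^ (α * q / θ) * P = P ^ (1 / θ) := by
    conv_lhs => rw [← ENNReal.rpow_one P, ← ENNReal.rpow_mul, one_mul,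
      ← ENNReal.rpow_add_of_nonneg _ _ (by positivity) zero_le_one]
    congr 1
    rw [div_add_one hθ.ne', hθdef, add_sub_cancel]
  calc m ^ (p / q - 1) * ∫⁻ z in ball x₀ r, modFracMax μ α β f z ^ (p / θ) ∂μ
      ≤ m ^ (p / q - 1) * ∑ y ∈ s,
          ∫⁻ x in ball x₀ r ∩ ball y (δ * r), modFracMax μ α β f x ^ (p / θ) ∂μ := by
        gcongr
        exact setLIntegral_le_sum_inter hcov _
    _ ≤ ∑ y ∈ s, D ^ (α * q * (p / θ)) * (C * N₁ * P + N₂ * P) := by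
        rw [Finset.mul_sum]
        exact Finset.sum_le_sum hpiece
    _ ≤ N₃ * (D ^ (α * q * (p / θ)) * (C * N₁ * P + N₂ * P)) := by
        rw [Finset.sum_const, nsmul_eq_mul]
        gcongr
    _ = N₃ * ((N₂ : ℝ≥0∞) ^ (α * q / θ) * (C * N₁ + N₂)) * (P ^ (α * q / θ) * P) := by
        rw [hDP]
        ring
    _ = _ := by rw [hPP]

end Morrey

theorem stmt17 {X : Type*} [MetricSpace X] [MeasurableSpace X] [BorelSpace X]
    (N₀ : ℕ) (hX : GeomDoubling X N₀) (μ : Measure X) [μ.Regular]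
    (p q : ℝ) (hp : 1 < p) (hpq : p ≤ q)
    (β k α : ℝ) (hβ : 1 < β) (hk : 1 < k) (hα0 : 0 < α) (hαq : α < 1 / q) :
    ∃ C : ℝ, 0 < C ∧
      ∀ f : X → ℝ, Measurable f → modMorreyNorm μ p q k f < ⊤ →
        modMorreyNormE μ (p / (1 - α * q)) (q / (1 - α * q)) k (modFracMax μ α β f) ≤
          ENNReal.ofReal C * modMorreyNorm μ p q k f := by
  have hp0 : 0 < p := zero_lt_one.trans hp
  have hq0 : 0 < q := hp0.trans_le hpq
  have hθ : 0 < 1 - α * q := sub_pos.2 ((lt_div_iff₀ hq0).1 hαq)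
  have := hX.secondCountableTopology
  have := isLocallyFiniteMeasure_of_regular μ
  obtain ⟨C, hC, hbound⟩ := hX.exists_fracMax_bound μ hp hpq hβ hk hα0 hαq
  set θ := 1 - α * q
  set C' : ℝ≥0∞ := C ^ (1 / (p / θ)) with hC'
  have hC'top : C' ≠ ⊤ := ENNReal.rpow_ne_top_of_nonneg (by positivity) hC
  refine ⟨C'.toReal + 1, by positivity, fun f hf _ => ?_⟩
  set A := modMorreyNorm μ p q k f with hA
  have hP : ∀ x r, 0 < r →
      μ (ball x (k * r)) ^ (p / q - 1) * ∫⁻ z in ball x r, (‖f z‖₊ : ℝ≥0∞) ^ p ∂μ ≤ A ^ p := by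
    intro x r hr
    have h : μ (ball x (k * r)) ^ (1 / q - 1 / p) *
        (∫⁻ y in ball x r, (‖f y‖₊ : ℝ≥0∞) ^ p ∂μ) ^ (1 / p) ≤ A :=
      le_iSup_of_le x <| le_iSup_of_le r <| le_iSup_of_le hr le_rfl
    have h' := ENNReal.rpow_le_rpow h hp0.le
    rw [ENNReal.mul_rpow_of_nonneg _ _ hp0.le, ← ENNReal.rpow_mul, ← ENNReal.rpow_mul,
      one_div_mul_cancel hp0.ne', ENNReal.rpow_one] at h'
    convert h' using 3
    field_simp
  refine iSup_le fun x => iSup_le fun r => iSup_le fun hr => ?_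
  have hexp : 1 / (q / θ) - 1 / (p / θ) = (p / q - 1) * (1 / (p / θ)) := by
    field_simp
  calc μ (ball x (k * r)) ^ (1 / (q / θ) - 1 / (p / θ)) *
        (∫⁻ y in ball x r, modFracMax μ α β f y ^ (p / θ) ∂μ) ^ (1 / (p / θ))
      = (μ (ball x (k * r)) ^ (p / q - 1) *
          ∫⁻ y in ball x r, modFracMax μ α β f y ^ (p / θ) ∂μ) ^ (1 / (p / θ)) := by
        rw [ENNReal.mul_rpow_of_nonneg _ _ (by positivity), ← ENNReal.rpow_mul, hexp]
    _ ≤ (C * (A ^ p) ^ (1 / θ)) ^ (1 / (p / θ)) := by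
        exact ENNReal.rpow_le_rpow (hbound f hf (A ^ p) hP x r hr) (by positivity)
    _ = C' * A := by
        rw [ENNReal.mul_rpow_of_nonneg _ _ (by positivity), ← ENNReal.rpow_mul,
          ← ENNReal.rpow_mul A, hC']
        have : p * (1 / θ * (1 / (p / θ))) = 1 := by field_simp
        rw [this, ENNReal.rpow_one]
    _ ≤ ENNReal.ofReal (C'.toReal + 1) * A := by
        gcongr
        rw [ENNReal.le_ofReal_iff_toReal_le hC'top (by positivity)]
        linarith
end
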